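/- arXiv:1009.2037 — 3 statements merged into one kernel-verified Lean document; each statement's English description precedes it below -/
import Mathlib

section
/- If z, z' ∈ ℂ are both non-integers, then the inner product (f,g) := ψ(fg) on the algebra of symmetric functions, where ψ(S_ν) = ∏_{□∈ν}(z+c(□))(z'+c(□))(dim ν/|ν|!)², is nondegenerate. -/
open scoped BigOperators

/-- `∏_{□∈s} (z + c(□))(z' + c(□))` where `c((i,j)) = j - i`. -/
noncomputable def contentProd {R : Type*} [CommRing R] (z z' : R) (s : Finset (ℕ × ℕ)) : R :=
  ∏ b ∈ s, ((z + (((b.2 : ℤ) - (b.1 : ℤ) : ℤ) : R)) * (z' + (((b.2 : ℤ) - (b.1 : ℤ) : ℤ) : R)))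

/-- Number of standard Young tableaux of skew shape `ν/μ`, i.e. of saturated chains
from `μ` to `ν` in the Young lattice. -/
noncomputable def dimSkew (μ ν : YoungDiagram) : ℕ :=
  Nat.card {c : ℕ → YoungDiagram //
    c 0 = μ ∧
    (∀ i, i < ν.card - μ.card → c i ≤ c (i + 1) ∧ (c (i + 1)).card = (c i).card + 1) ∧
    ∀ i, ν.card - μ.card ≤ i → c i = ν}

/-- Elementary symmetric function `e_k` as a generator of `Λ = ℂ[e₁,e₂,…]`,
with `e_0 = 1` and `e_k = 0` for `k < 0`. -/
noncomputable def eGen (k : ℤ) : MvPolynomial ℕ ℂ :=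
  if k < 0 then 0 else if k = 0 then 1 else MvPolynomial.X (k.toNat - 1)

/-- Schur function via the Nägelsbach–Kostka formula `S_ν = det[e_{ν'_i - i + j}]`. -/
noncomputable def SchurF (ν : YoungDiagram) : MvPolynomial ℕ ℂ :=
  Matrix.det (Matrix.of fun i j : Fin (ν.rowLen 0) =>
    eGen ((ν.colLen i : ℤ) - (i : ℤ) + (j : ℤ)))

/-- Coefficient of the Laguerre symmetric functions in the Schur basis. -/
noncomputable def LagC (z z' : ℂ) (ν μ : YoungDiagram) : ℂ :=
  (-1) ^ (ν.card - μ.card) * (dimSkew μ ν : ℂ) / (Nat.factorial (ν.card - μ.card) : ℂ)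
    * contentProd z z' (ν.cells \ μ.cells)

/-- The Laguerre symmetric function `𝕃_ν`. -/
noncomputable def LaguerreSF (z z' : ℂ) (ν : YoungDiagram) : MvPolynomial ℕ ℂ :=
  ∑ᶠ (μ : YoungDiagram) (_ : μ ≤ ν), LagC z z' ν μ • SchurF μ

open Filter Topology

/-! ### Column-adding operators -/

section ColumnOperators

open Polynomial

theorem eGen_neg {k : ℤ} (hk : k < 0) : eGen k = 0 := by simp [eGen, hk]

@[simp] theorem eGen_zero : eGen 0 = 1 := by simp [eGen]

theorem eGen_natCast_succ (j : ℕ) : eGen ((j : ℤ) + 1) = MvPolynomial.X j := by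
  have h1 : ¬ ((j : ℤ) + 1 < 0) := by omega
  have h2 : (j : ℤ) + 1 ≠ 0 := by omega
  have h3 : ((j : ℤ) + 1).toNat - 1 = j := by omega
  simp only [eGen, h1, h2, h3, if_false]

/-- The algebra homomorphism with `e_k ↦ e_k - X e_{k-1}`, which multiplies the generating
series of the elementary symmetric functions by `1 - Xq`. -/
noncomputable def removeVar : MvPolynomial ℕ ℂ →ₐ[ℂ] (MvPolynomial ℕ ℂ)[X] :=
  MvPolynomial.aeval fun j : ℕ => C (eGen ((j : ℤ) + 1)) - X * C (eGen (j : ℤ))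

theorem removeVar_eGen (k : ℤ) :
    removeVar (eGen k) = C (eGen k) - X * C (eGen (k - 1)) := by
  rcases lt_trichotomy k 0 with hk | rfl | hk
  · rw [eGen_neg hk, eGen_neg (show k - 1 < 0 by omega)]
    simp
  · rw [eGen_neg (show (0 : ℤ) - 1 < 0 by omega)]
    simp
  · obtain ⟨j, rfl⟩ : ∃ j : ℕ, k = (j : ℤ) + 1 := ⟨(k - 1).toNat, by omega⟩
    rw [add_sub_cancel_right]
    conv_lhs => rw [eGen_natCast_succ]
    simp only [removeVar, MvPolynomial.aeval_X]

/-- The linear map replacing `X ^ i` by `e_{a+i}`. -/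
noncomputable def substGen (a : ℤ) :
    (MvPolynomial ℕ ℂ)[X] →ₗ[MvPolynomial ℕ ℂ] MvPolynomial ℕ ℂ :=
  lsum fun i => LinearMap.mulRight (MvPolynomial ℕ ℂ) (eGen (a + (i : ℤ)))

theorem substGen_monomial (a : ℤ) (i : ℕ) (c : MvPolynomial ℕ ℂ) :
    substGen a (monomial i c) = c * eGen (a + i) := by
  simp [substGen, lsum, sum_monomial_index]

theorem substGen_C_mul (a : ℤ) (c : MvPolynomial ℕ ℂ) (P : (MvPolynomial ℕ ℂ)[X]) :
    substGen a (C c * P) = c * substGen a P := by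
  rw [← smul_eq_C_mul, map_smul, smul_eq_mul]

theorem substGen_X_mul (a : ℤ) (P : (MvPolynomial ℕ ℂ)[X]) :
    substGen a (X * P) = substGen (a + 1) P := by
  induction P using Polynomial.induction_on' with
  | add p q hp hq => rw [mul_add, map_add, map_add, hp, hq]
  | monomial n c =>
    rw [X_mul_monomial, substGen_monomial, substGen_monomial]
    push_cast
    rw [add_assoc, add_comm 1 (n : ℤ)]

/-- The operator on symmetric functions which adds a column of length `a` to the left of
a Young diagram. -/
noncomputable def addColumn (a : ℤ) : MvPolynomial ℕ ℂ →ₗ[ℂ] MvPolynomial ℕ ℂ :=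
  (substGen a).restrictScalars ℂ ∘ₗ removeVar.toLinearMap

theorem addColumn_apply (a : ℤ) (F : MvPolynomial ℕ ℂ) :
    addColumn a F = substGen a (removeVar F) := rfl

@[simp] theorem addColumn_one (a : ℤ) : addColumn a 1 = eGen a := by
  rw [addColumn_apply, map_one, ← monomial_zero_one, substGen_monomial]
  simp

theorem addColumn_eGen_mul (a k : ℤ) (F : MvPolynomial ℕ ℂ) :
    addColumn a (eGen k * F) =
      eGen k * addColumn a F - eGen (k - 1) * addColumn (a + 1) F := by
  simp only [addColumn_apply, map_mul, removeVar_eGen, sub_mul, map_sub, mul_assoc,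
    substGen_C_mul, substGen_X_mul]

/-- The determinant `det[e_{c_i - i + j}]` for an arbitrary integer vector `c`. -/
noncomputable def columnDet {n : ℕ} (c : Fin n → ℤ) : MvPolynomial ℕ ℂ :=
  Matrix.det (Matrix.of fun i j : Fin n => eGen (c i - (i : ℤ) + (j : ℤ)))

theorem addColumn_columnDet (a : ℤ) {n : ℕ} (c : Fin n → ℤ) :
    addColumn a (columnDet c) = columnDet (Fin.cons a c : Fin (n + 1) → ℤ) := by
  set N : Matrix (Fin (n + 1)) (Fin (n + 1)) (MvPolynomial ℕ ℂ)[X] :=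
    Matrix.of (Fin.cons (fun j => X ^ (j : ℕ))
      fun i j => C (eGen (c i - ((i : ℤ) + 1) + (j : ℤ)))) with hN
  set B : Matrix (Fin (n + 1)) (Fin (n + 1)) (MvPolynomial ℕ ℂ)[X] :=
    Matrix.of fun i => Fin.cons (N i 0) fun j => N i j.succ - X * N i j.castSucc with hB
  have hdet : N.det = B.det := by
    refine Matrix.det_eq_of_forall_col_eq_smul_add_pred (fun _ => X) ?_ ?_
    · intro i; simp [hB]
    · intro i j; simp [hB]
  have hB0 : ∀ j : Fin n, B 0 j.succ = 0 := by
    intro j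
    simp [hB, hN, pow_succ']
  have hBdet : B.det = removeVar (columnDet c) := by
    rw [Matrix.det_succ_row_zero, Fin.sum_univ_succ]
    rw [Finset.sum_eq_zero (fun j _ => by rw [hB0]; simp), columnDet, AlgHom.map_det]
    simp only [add_zero]
    have : B 0 0 = 1 := by simp [hB, hN]
    rw [this]
    simp only [Fin.val_zero, pow_zero, one_mul]
    congr 1
    ext1 i j
    simp only [Matrix.submatrix_apply, AlgHom.mapMatrix_apply, Matrix.map_apply, Matrix.of_apply,
      removeVar_eGen, hB, hN, Fin.succAbove_zero, Fin.cons_succ, Fin.val_succ, Fin.val_castSucc]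
    have h1 : c i - ((i : ℤ) + 1) + ((j : ℤ) + 1) = c i - i + j := by ring
    have h2 : c i - ((i : ℤ) + 1) + (j : ℤ) = c i - i + j - 1 := by ring
    push_cast
    rw [h1, h2]
  rw [addColumn_apply, ← hBdet, ← hdet, Matrix.det_succ_row_zero, columnDet,
    Matrix.det_succ_row_zero, map_sum]
  refine Finset.sum_congr rfl fun j _ => ?_
  have hminor : (N.submatrix Fin.succ j.succAbove).det =
      C ((Matrix.of fun i k : Fin (n + 1) =>
        eGen ((Fin.cons a c : Fin (n + 1) → ℤ) i - (i : ℤ) + (k : ℤ))).submatrix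
          Fin.succ j.succAbove).det := by
    rw [RingHom.map_det]
    congr 1
  rw [hminor]
  have : N 0 j = X ^ (j : ℕ) := by simp [hN]
  rw [this]
  have h2 : ((-1) ^ (j : ℕ) * X ^ (j : ℕ) : (MvPolynomial ℕ ℂ)[X]) =
      monomial (j : ℕ) ((-1) ^ (j : ℕ)) := by
    rw [← C_mul_X_pow_eq_monomial]; simp
  rw [h2, mul_comm, substGen_C_mul, substGen_monomial]
  simp only [Matrix.of_apply, Fin.cons_zero, Fin.val_zero, Nat.cast_zero, sub_zero]
  ring

end ColumnOperators

/-! ### Spanning by column determinants -/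

theorem eGen_mul_addColumn (a k : ℤ) (F : MvPolynomial ℕ ℂ) :
    eGen k * addColumn a F =
      addColumn a (eGen k * F) + eGen (k - 1) * addColumn (a + 1) F := by
  rw [addColumn_eGen_mul]; ring

theorem addColumn_addColumn_eGen_mul (a b k : ℤ) (F : MvPolynomial ℕ ℂ) :
    addColumn a (addColumn b (eGen k * F)) =
      eGen k * addColumn a (addColumn b F) - eGen (k - 1) * addColumn (a + 1) (addColumn b F)
        - eGen (k - 1) * addColumn a (addColumn (b + 1) F)
        + eGen (k - 2) * addColumn (a + 1) (addColumn (b + 1) F) := by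
  rw [addColumn_eGen_mul b, map_sub, addColumn_eGen_mul a, addColumn_eGen_mul a]
  rw [show k - 1 - 1 = k - 2 by ring]
  ring

theorem columnDet_fin_zero (c : Fin 0 → ℤ) : columnDet c = 1 := by
  simp [columnDet]

theorem columnDet_cons (a : ℤ) {n : ℕ} (c : Fin n → ℤ) :
    columnDet (Fin.cons a c : Fin (n + 1) → ℤ) = addColumn a (columnDet c) :=
  (addColumn_columnDet a c).symm

theorem span_range_columnDet :
    Submodule.span ℂ (Set.range fun p : Σ n, Fin n → ℤ => columnDet p.2) = ⊤ := by
  set M := Submodule.span ℂ (Set.range fun p : Σ n, Fin n → ℤ => columnDet p.2) with hM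
  have hmem : ∀ {n : ℕ} (c : Fin n → ℤ), columnDet c ∈ M := fun {n} c =>
    Submodule.subset_span ⟨⟨n, c⟩, rfl⟩
  have hadd : ∀ a : ℤ, ∀ F ∈ M, addColumn a F ∈ M := by
    intro a F hF
    induction hF using Submodule.span_induction with
    | mem x hx =>
      obtain ⟨⟨n, c⟩, rfl⟩ := hx
      simp only [addColumn_columnDet]
      exact hmem _
    | zero => simp
    | add x y _ _ hx hy => rw [map_add]; exact M.add_mem hx hy
    | smul t x _ hx => rw [map_smul]; exact M.smul_mem t hx
  have hmul : ∀ (n : ℕ) (c : Fin n → ℤ) (k : ℕ), eGen k * columnDet c ∈ M := by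
    intro n
    induction n with
    | zero =>
      intro c k
      have := hmem (Fin.cons (k : ℤ) c : Fin 1 → ℤ)
      rw [columnDet_cons, columnDet_fin_zero, addColumn_one] at this
      simpa [columnDet_fin_zero] using this
    | succ n ih =>
      intro c k
      rw [← Fin.cons_self_tail c, columnDet_cons]
      generalize c 0 = a
      induction k generalizing a with
      | zero => simpa using hadd a _ (hmem _)
      | succ k ihk =>
        rw [eGen_mul_addColumn]
        refine M.add_mem (hadd _ _ (ih _ _)) ?_
        simpa using ihk (a + 1)
  have hX : ∀ i : ℕ, ∀ F ∈ M, F * MvPolynomial.X i ∈ M := by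
    intro i F hF
    induction hF using Submodule.span_induction with
    | mem x hx =>
      obtain ⟨⟨n, c⟩, rfl⟩ := hx
      have := hmul n c (i + 1)
      rw [Nat.cast_succ, eGen_natCast_succ] at this
      rwa [mul_comm]
    | zero => simp
    | add x y _ _ hx hy => rw [add_mul]; exact M.add_mem hx hy
    | smul t x _ hx => rw [smul_mul_assoc]; exact M.smul_mem t hx
  refine (Submodule.eq_top_iff').2 fun F => ?_
  induction F using MvPolynomial.induction_on with
  | C a =>
    have := M.smul_mem a (hmem (Fin.elim0 : Fin 0 → ℤ))
    rwa [columnDet_fin_zero, MvPolynomial.smul_eq_C_mul, mul_one] at this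
  | add p q hp hq => exact M.add_mem hp hq
  | mul_X p i hp => exact hX i p hp

theorem columnDet_eq_zero_of_not_injective {n : ℕ} (c : Fin n → ℤ)
    (hc : ¬ Function.Injective fun i => c i - (i : ℤ)) : columnDet c = 0 := by
  simp only [Function.Injective, not_forall] at hc
  obtain ⟨i, j, hij, hne⟩ := hc
  refine Matrix.det_zero_of_row_eq hne ?_
  ext1 k
  simp only [Matrix.of_apply, hij]

theorem columnDet_eq_zero_of_last_neg {n : ℕ} (c : Fin (n + 1) → ℤ) (hc : c (Fin.last n) < 0) :
    columnDet c = 0 := by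
  refine Matrix.det_eq_zero_of_row_eq_zero (Fin.last n) fun j => ?_
  rw [Matrix.of_apply, eGen_neg]
  have := j.is_le
  rw [Fin.val_last]
  omega

theorem columnDet_perm {n : ℕ} (c : Fin n → ℤ) (σ : Equiv.Perm (Fin n)) :
    columnDet (fun i => c (σ i) - (σ i : ℤ) + (i : ℤ)) =
      (Equiv.Perm.sign σ : ℤ) * columnDet c := by
  have := Matrix.det_permute σ (Matrix.of fun i j : Fin n => eGen (c i - (i : ℤ) + (j : ℤ)))
  rw [columnDet, columnDet, ← this]
  congr 1
  ext1 i j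
  simp

theorem columnDet_swap (a b : ℤ) {n : ℕ} (c : Fin n → ℤ) :
    addColumn a (addColumn b (columnDet c)) =
      - addColumn (b - 1) (addColumn (a + 1) (columnDet c)) := by
  simp only [addColumn_columnDet]
  have := columnDet_perm (Fin.cons a (Fin.cons b c : Fin (n + 1) → ℤ) : Fin (n + 2) → ℤ)
    (Equiv.swap 0 1)
  rw [Equiv.Perm.sign_swap (by simp)] at this
  simp only [Units.val_neg, Units.val_one, Int.cast_neg, Int.cast_one, neg_mul, one_mul] at this
  rw [eq_neg_iff_add_eq_zero, ← neg_inj, neg_add, neg_zero, ← this, add_neg_eq_zero]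
  congr 1
  ext1 i
  refine Fin.cases ?_ (fun i => Fin.cases ?_ (fun i => ?_) i) i
  · simp
  · simp
  · rw [Equiv.swap_apply_of_ne_of_ne]
    · simp
    · exact Fin.succ_ne_zero _
    · exact fun h => Fin.succ_ne_zero i (Fin.succ_injective _ h)

theorem addColumn_swap (a b : ℤ) (F : MvPolynomial ℕ ℂ) :
    addColumn a (addColumn b F) = - addColumn (b - 1) (addColumn (a + 1) F) := by
  have : addColumn a ∘ₗ addColumn b = - (addColumn (b - 1) ∘ₗ addColumn (a + 1)) := by
    refine LinearMap.ext_on_range span_range_columnDet fun p => ?_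
    exact columnDet_swap a b p.2
  exact LinearMap.congr_fun this F

theorem span_range_columnDet_antitone :
    Submodule.span ℂ (Set.range fun p : Σ n, {l : Fin n → ℕ // Antitone l} =>
      columnDet fun i => (p.2.1 i : ℤ)) = ⊤ := by
  rw [eq_top_iff, ← span_range_columnDet, Submodule.span_le]
  rintro _ ⟨⟨n, c⟩, rfl⟩
  simp only [SetLike.mem_coe]
  by_cases hinj : Function.Injective fun i => c i - (i : ℤ)
  swap
  · rw [columnDet_eq_zero_of_not_injective c hinj]; exact Submodule.zero_mem _
  set v : Fin n → ℤ := fun i => c i - (i : ℤ) with hv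
  set σ := Tuple.sort fun i => - v i with hσ
  have hmono : Monotone fun i => - v (σ i) := Tuple.monotone_sort fun i => - v i
  have hanti : StrictAnti fun i => v (σ i) := by
    refine (Antitone.strictAnti_iff_injective ?_).2 (hinj.comp σ.injective)
    intro i j hij
    simpa using hmono hij
  have hperm := columnDet_perm c σ
  set d : Fin n → ℤ := fun i => c (σ i) - (σ i : ℤ) + (i : ℤ) with hd
  have hdanti : Antitone d := by
    cases n with
    | zero => exact fun i => i.elim0
    | succ n =>
      refine Fin.antitone_iff_succ_le.2 fun i => ?_
      have := hanti (Fin.castSucc_lt_succ (i := i))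
      simp only [hv] at this
      simp only [hd, Fin.val_succ, Fin.val_castSucc]
      push_cast
      omega
  have key : columnDet d ∈ Submodule.span ℂ (Set.range fun p : Σ n, {l : Fin n → ℕ // Antitone l} =>
      columnDet fun i => (p.2.1 i : ℤ)) := by
    by_cases hneg : ∃ i, d i < 0
    · obtain ⟨i, hi⟩ := hneg
      cases n with
      | zero => exact i.elim0
      | succ n =>
        rw [columnDet_eq_zero_of_last_neg d ((hdanti (Fin.le_last i)).trans_lt hi)]
        exact Submodule.zero_mem _
    · push Not at hneg
      refine Submodule.subset_span ⟨⟨n, fun i => (d i).toNat, fun i j hij => ?_⟩, ?_⟩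
      · exact Int.toNat_le_toNat (hdanti hij)
      · simp only [Int.toNat_of_nonneg (hneg _)]
  rcases Int.units_eq_one_or (Equiv.Perm.sign σ) with h | h
  · rw [h] at hperm
    have : columnDet c = columnDet d := by rw [hperm]; simp
    rw [this]
    exact key
  · rw [h] at hperm
    have : columnDet c = - columnDet d := by rw [hperm]; simp
    rw [this]
    exact Submodule.neg_mem _ key

/-! ### Young diagrams through their column lengths -/

namespace YoungDiagram

theorem ext_colLen {μ ν : YoungDiagram} (h : ∀ j, μ.colLen j = ν.colLen j) : μ = ν := by
  ext ⟨i, j⟩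
  rw [mem_cells, mem_cells, mem_iff_lt_colLen, mem_iff_lt_colLen, h]

theorem le_iff_colLen_le {μ ν : YoungDiagram} : μ ≤ ν ↔ ∀ j, μ.colLen j ≤ ν.colLen j := by
  constructor
  · intro h j
    by_contra! hlt
    exact lt_irrefl _ (mem_iff_lt_colLen.1 (h (mem_iff_lt_colLen.2 hlt)))
  · rintro h ⟨i, j⟩ hm
    exact mem_iff_lt_colLen.2 ((mem_iff_lt_colLen.1 hm).trans_le (h j))

theorem colLen_eq_zero_iff {ν : YoungDiagram} {j : ℕ} : ν.colLen j = 0 ↔ ν.rowLen 0 ≤ j := by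
  rw [← not_iff_not, ← ne_eq, ← pos_iff_ne_zero, ← mem_iff_lt_colLen, mem_iff_lt_rowLen, not_le]

theorem exists_colLen_eq (l : ℕ → ℕ) (hl : Antitone l) (n : ℕ) (hn : l n = 0) :
    ∃ ν : YoungDiagram, ∀ j, ν.colLen j = l j := by
  have hlt : ∀ {t j : ℕ}, t < l j → j < n ∧ t < l 0 := by
    intro t j h
    refine ⟨?_, h.trans_le (hl (Nat.zero_le j))⟩
    by_contra! hj
    have := hl hj
    omega
  refine ⟨⟨((Finset.range (l 0)) ×ˢ Finset.range n).filter fun p => p.1 < l p.2, ?_⟩, fun j => ?_⟩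
  · rintro ⟨t, j⟩ ⟨t', j'⟩ ⟨ht, hj⟩ hm
    simp only [Finset.coe_filter, Finset.mem_product, Finset.mem_range, Set.mem_ofPred_eq] at hm ⊢
    have : t' < l j' := lt_of_le_of_lt ht (hm.2.trans_le (hl hj))
    exact ⟨(hlt this).symm, this⟩
  · refine eq_of_forall_lt_iff fun t => ?_
    rw [← mem_iff_lt_colLen, ← mem_cells]
    simp only [Finset.mem_filter, Finset.mem_product, Finset.mem_range]
    exact ⟨fun h => h.2, fun h => ⟨(hlt h).symm, h⟩⟩

@[to_additive]
theorem prod_cells {M : Type*} [CommMonoid M] (ν : YoungDiagram) (f : ℕ × ℕ → M) {n : ℕ}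
    (hn : ν.rowLen 0 ≤ n) :
    ∏ b ∈ ν.cells, f b = ∏ j : Fin n, ∏ t ∈ Finset.range (ν.colLen j), f (t, j) := by
  rw [Fin.prod_univ_eq_prod_range fun j => ∏ t ∈ Finset.range (ν.colLen j), f (t, j)]
  refine Finset.prod_finset_product_right _ _ _ fun ⟨t, j⟩ => ?_
  simp only [mem_cells, Finset.mem_range, mem_iff_lt_colLen]
  refine ⟨fun h => ⟨?_, h⟩, fun h => h.2⟩
  by_contra! hj
  have := colLen_eq_zero_iff.2 (hn.trans hj)
  omega

theorem card_eq_sum_colLen (ν : YoungDiagram) {n : ℕ} (hn : ν.rowLen 0 ≤ n) :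
    ν.card = ∑ j : Fin n, ν.colLen j := by
  have := sum_cells ν (fun _ => 1) hn
  simpa using this

end YoungDiagram

theorem columnDet_snoc_zero {n : ℕ} (c : Fin (n + 1) → ℤ) (hc : c (Fin.last n) = 0) :
    columnDet c = columnDet fun i : Fin n => c i.castSucc := by
  rw [columnDet, Matrix.det_succ_row _ (Fin.last n), Fin.sum_univ_castSucc,
    Finset.sum_eq_zero, columnDet]
  · simp [hc, Matrix.submatrix]
  · intro j _
    have h : eGen (c (Fin.last n) - (n : ℤ) + (j : ℤ)) = 0 := by
      apply eGen_neg
      have := j.is_lt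
      omega
    simp [h]

theorem SchurF_eq_columnDet (ν : YoungDiagram) {n : ℕ} (hn : ν.rowLen 0 ≤ n) :
    SchurF ν = columnDet fun i : Fin n => (ν.colLen i : ℤ) := by
  induction n, hn using Nat.le_induction with
  | base => rfl
  | succ n hn ih =>
    rw [columnDet_snoc_zero, ih]
    · rfl
    · simpa using YoungDiagram.colLen_eq_zero_iff.2 hn

theorem exists_youngDiagram_of_antitone {n : ℕ} (l : Fin n → ℕ) (hl : Antitone l) :
    ∃ ν : YoungDiagram, ν.rowLen 0 ≤ n ∧ ∀ j : Fin n, ν.colLen j = l j := by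
  obtain ⟨ν, hν⟩ := YoungDiagram.exists_colLen_eq (fun j => if h : j < n then l ⟨j, h⟩ else 0)
    (by
      intro i j hij
      by_cases hj : j < n
      · simp only [hj, lt_of_le_of_lt hij hj, dif_pos]
        exact hl hij
      · simp [hj]) n (by simp)
  refine ⟨ν, ?_, fun j => ?_⟩
  · rw [← YoungDiagram.colLen_eq_zero_iff, hν]
    simp
  · rw [hν]
    simp

/-- The content product of the Young diagram with column lengths `l`. -/
noncomputable def columnContent (z z' : ℂ) {n : ℕ} (l : Fin n → ℕ) : ℂ :=
  ∏ j : Fin n, ∏ t ∈ Finset.range (l j), (z + j - t) * (z' + j - t)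

theorem contentProd_cells (z z' : ℂ) (ν : YoungDiagram) {n : ℕ} (hn : ν.rowLen 0 ≤ n) :
    contentProd z z' ν.cells = columnContent z z' fun j : Fin n => ν.colLen j := by
  rw [contentProd, YoungDiagram.prod_cells ν _ hn, columnContent]
  refine Finset.prod_congr rfl fun j _ => Finset.prod_congr rfl fun t _ => ?_
  push_cast
  ring

theorem columnContent_cons (z z' : ℂ) (a : ℕ) {n : ℕ} (l : Fin n → ℕ) :
    columnContent z z' (Fin.cons a l : Fin (n + 1) → ℕ) =
      (∏ t ∈ Finset.range a, (z - t) * (z' - t)) * columnContent (z + 1) (z' + 1) l := by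
  rw [columnContent, Fin.prod_univ_succ, columnContent]
  congr 1
  · simp
  · refine Finset.prod_congr rfl fun j _ => ?_
    rw [Fin.cons_succ]
    refine Finset.prod_congr rfl fun t _ => ?_
    push_cast [Fin.val_succ]
    ring

/-! ### The exponential specialization and the dimension -/

/-- `1 / k!`, extended by zero to negative integers. -/
noncomputable def invFact (k : ℤ) : ℂ :=
  if k < 0 then 0 else ((k.toNat.factorial : ℕ) : ℂ)⁻¹

theorem invFact_neg {k : ℤ} (hk : k < 0) : invFact k = 0 := by simp [invFact, hk]

theorem invFact_natCast (k : ℕ) : invFact k = ((k.factorial : ℕ) : ℂ)⁻¹ := by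
  simp [invFact]

@[simp] theorem invFact_zero : invFact 0 = 1 := by simp [invFact]

theorem invFact_ne_zero {k : ℤ} (hk : 0 ≤ k) : invFact k ≠ 0 := by
  obtain ⟨k, rfl⟩ := Int.eq_ofNat_of_zero_le hk
  rw [invFact_natCast]
  exact inv_ne_zero (Nat.cast_ne_zero.2 k.factorial_ne_zero)

theorem invFact_sub_one (k : ℤ) : invFact (k - 1) = k * invFact k := by
  rcases lt_trichotomy k 0 with hk | rfl | hk
  · rw [invFact_neg hk, invFact_neg (show k - 1 < 0 by omega), mul_zero]
  · rw [invFact_neg (by omega)]; simp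
  · obtain ⟨j, rfl⟩ : ∃ j : ℕ, k = ((j + 1 : ℕ) : ℤ) := ⟨(k - 1).toNat, by omega⟩
    rw [show ((j + 1 : ℕ) : ℤ) - 1 = (j : ℤ) by push_cast; ring, invFact_natCast,
      invFact_natCast, Nat.factorial_succ]
    have h1 : ((j.factorial : ℕ) : ℂ) ≠ 0 := Nat.cast_ne_zero.2 j.factorial_ne_zero
    have h2 : ((j + 1 : ℕ) : ℂ) ≠ 0 := Nat.cast_ne_zero.2 j.succ_ne_zero
    push_cast at h2 ⊢
    field_simp

/-- The exponential specialization `e_k ↦ 1 / k!`. -/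
noncomputable def expSpec : MvPolynomial ℕ ℂ →ₐ[ℂ] ℂ :=
  MvPolynomial.aeval fun j : ℕ => invFact ((j : ℤ) + 1)

theorem expSpec_eGen (k : ℤ) : expSpec (eGen k) = invFact k := by
  rcases lt_trichotomy k 0 with hk | rfl | hk
  · rw [eGen_neg hk, invFact_neg hk, map_zero]
  · simp
  · obtain ⟨j, rfl⟩ : ∃ j : ℕ, k = (j : ℤ) + 1 := ⟨(k - 1).toNat, by omega⟩
    rw [eGen_natCast_succ, expSpec, MvPolynomial.aeval_X]

theorem expSpec_columnDet {n : ℕ} (c : Fin n → ℤ) :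
    expSpec (columnDet c) =
      Matrix.det (Matrix.of fun i j : Fin n => invFact (c i - (i : ℤ) + (j : ℤ))) := by
  rw [columnDet, AlgHom.map_det]
  congr 1
  ext1 i j
  simp [expSpec_eGen]

theorem Matrix.sum_det_updateRow_mul_diagonal {R ι : Type*} [CommRing R] [Fintype ι]
    [DecidableEq ι] (M : Matrix ι ι R) (d : ι → R) :
    ∑ i, (M.updateRow i fun j => d j * M i j).det = (∑ j, d j) * M.det := by
  simp_rw [← Matrix.cramer_transpose_apply, Matrix.cramer_eq_adjugate_mulVec, Matrix.mulVec,
    dotProduct]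
  rw [Finset.sum_comm, Finset.sum_mul]
  refine Finset.sum_congr rfl fun j _ => ?_
  have := congrFun (congrFun (Matrix.adjugate_mul M) j) j
  rw [Matrix.mul_apply, Matrix.smul_apply, Matrix.one_apply_eq, smul_eq_mul, mul_one] at this
  rw [← this, Finset.mul_sum]
  refine Finset.sum_congr rfl fun i _ => ?_
  rw [← Matrix.adjugate_transpose, Matrix.transpose_apply]
  ring

theorem sum_expSpec_columnDet_lower {n : ℕ} (c : Fin n → ℤ) :
    ∑ i, expSpec (columnDet (Function.update c i (c i - 1))) =
      (∑ i, (c i : ℂ)) * expSpec (columnDet c) := by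
  set M : Matrix (Fin n) (Fin n) ℂ :=
    Matrix.of fun i j : Fin n => invFact (c i - (i : ℤ) + (j : ℤ)) with hM
  have h : ∀ i, expSpec (columnDet (Function.update c i (c i - 1))) =
        ((c i : ℂ) - (i : ℕ)) * M.det +
          (M.updateRow i fun j : Fin n => ((j : ℕ) : ℂ) * M i j).det := by
    intro i
    have h1 : (Matrix.of fun k j : Fin n =>
        invFact (Function.update c i (c i - 1) k - (k : ℤ) + (j : ℤ))) =
        M.updateRow i (((c i : ℂ) - (i : ℕ)) • M i + fun j : Fin n => ((j : ℕ) : ℂ) * M i j) := by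
      ext k j
      by_cases hk : k = i
      · subst hk
        simp only [Matrix.of_apply, Function.update_self, Matrix.updateRow_self, Pi.add_apply,
          Pi.smul_apply, smul_eq_mul, hM]
        rw [show c k - 1 - (k : ℤ) + (j : ℤ) = (c k - k + j) - 1 by ring, invFact_sub_one]
        push_cast
        ring
      · simp [hk, hM]
    rw [expSpec_columnDet, h1, Matrix.det_updateRow_add, Matrix.det_updateRow_smul,
      Matrix.updateRow_eq_self]
  simp_rw [h, Finset.sum_add_distrib, Matrix.sum_det_updateRow_mul_diagonal, ← Finset.sum_mul,
    Finset.sum_sub_distrib, expSpec_columnDet, ← hM]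
  ring

/-- Saturated chains in the Young lattice from the empty diagram to `ν`. -/
abbrev TableauChain (ν : YoungDiagram) : Type :=
  {c : ℕ → YoungDiagram // c 0 = ⊥ ∧
    (∀ i, i < ν.card → c i ≤ c (i + 1) ∧ (c (i + 1)).card = (c i).card + 1) ∧
    ∀ i, ν.card ≤ i → c i = ν}

theorem YoungDiagram.card_bot : (⊥ : YoungDiagram).card = 0 := Finset.card_empty

theorem dimSkew_bot (ν : YoungDiagram) : dimSkew ⊥ ν = Nat.card (TableauChain ν) := by
  simp only [dimSkew, YoungDiagram.card_bot, Nat.sub_zero]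

/-- The diagrams obtained from `ν` by removing a box. -/
abbrev LowerDiagram (ν : YoungDiagram) : Type :=
  {μ : YoungDiagram // μ ≤ ν ∧ μ.card + 1 = ν.card}

instance (ν : YoungDiagram) : Finite (LowerDiagram ν) := by
  refine Finite.of_injective (β := ν.cells.powerset)
    (fun μ => ⟨μ.1.cells, Finset.mem_powerset.2 μ.2.1⟩) fun μ μ' h => ?_
  exact Subtype.ext (YoungDiagram.ext (congrArg Subtype.val h))

theorem TableauChain.card_apply {ν : YoungDiagram} (c : TableauChain ν) {i : ℕ}
    (hi : i ≤ ν.card) : (c.1 i).card = i := by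
  induction i with
  | zero => rw [c.2.1, YoungDiagram.card_bot]
  | succ i ih => rw [(c.2.2.1 i (by omega)).2, ih (by omega)]

/-- Extend a chain by one step. -/
def TableauChain.extend {ν : YoungDiagram} (p : Σ μ : LowerDiagram ν, TableauChain μ.1) :
    TableauChain ν :=
  ⟨fun i => if i < ν.card then p.2.1 i else ν, by
    have hc := p.1.2.2
    refine ⟨?_, fun i hi => ?_, fun i hi => if_neg (by omega)⟩
    · simp only [if_pos (show 0 < ν.card by omega)]
      exact p.2.2.1
    · simp only [if_pos hi]
      by_cases h : i + 1 < ν.card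
      · rw [if_pos h]
        exact p.2.2.2.1 i (by omega)
      · rw [if_neg h, p.2.2.2.2 i (by omega)]
        exact ⟨p.1.2.1, hc.symm⟩⟩

theorem TableauChain.bijective_extend {ν : YoungDiagram} (hν : 0 < ν.card) :
    Function.Bijective (TableauChain.extend (ν := ν)) := by
  constructor
  · rintro ⟨⟨μ, hμ, hc⟩, c⟩ ⟨⟨μ', hμ', hc'⟩, c'⟩ h
    have h' : ∀ i, i < ν.card → c.1 i = c'.1 i := by
      intro i hi
      have := congrFun (congrArg Subtype.val h) i
      simpa only [TableauChain.extend, if_pos hi] using this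
    obtain rfl : μ = μ' := by
      have h1 : c.1 (ν.card - 1) = μ := c.2.2.2 (ν.card - 1) (by simp only; omega)
      have h2 : c'.1 (ν.card - 1) = μ' := c'.2.2.2 (ν.card - 1) (by simp only; omega)
      rw [← h1, ← h2, h' _ (by omega)]
    congr 1
    refine Subtype.ext (funext fun i => ?_)
    by_cases hi : i < ν.card
    · exact h' i hi
    · rw [c.2.2.2 i (by simp only; omega), c'.2.2.2 i (by simp only; omega)]
  · intro c
    have hc := c.card_apply (i := ν.card - 1) (by omega)
    have hle := (c.2.2.1 (ν.card - 1) (by omega)).1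
    rw [c.2.2.2 (ν.card - 1 + 1) (by omega)] at hle
    refine ⟨⟨⟨c.1 (ν.card - 1), hle, by omega⟩,
      ⟨fun i => c.1 (min i (ν.card - 1)), ?_, fun i hi => ?_, fun i hi => ?_⟩⟩, ?_⟩
    · simpa using c.2.1
    · rw [hc] at hi
      simp only [min_eq_left hi.le, min_eq_left (Nat.succ_le_of_lt hi)]
      exact c.2.2.1 i (by omega)
    · rw [hc] at hi
      simp only [min_eq_right hi]
    · refine Subtype.ext (funext fun i => ?_)
      simp only [TableauChain.extend]
      split_ifs with h
      · rw [min_eq_left (by omega)]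
      · exact (c.2.2.2 i (by omega)).symm

instance TableauChain.finite (ν : YoungDiagram) : Finite (TableauChain ν) := by
  induction h : ν.card generalizing ν with
  | zero =>
    refine @Finite.of_subsingleton _ ⟨fun c c' => Subtype.ext (funext fun i => ?_)⟩
    rw [c.2.2.2 i (by omega), c'.2.2.2 i (by omega)]
  | succ n ih =>
    have : ∀ μ : LowerDiagram ν, Finite (TableauChain μ.1) := fun μ => ih μ.1 (by
      have := μ.2.2
      omega)
    exact Finite.of_surjective _ (TableauChain.bijective_extend (by omega)).2

theorem dimSkew_bot_eq_sum (ν : YoungDiagram) (hν : 0 < ν.card) [Fintype (LowerDiagram ν)] :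
    dimSkew ⊥ ν = ∑ μ : LowerDiagram ν, dimSkew ⊥ μ.1 := by
  simp_rw [dimSkew_bot]
  rw [← Nat.card_sigma]
  exact (Nat.card_congr (Equiv.ofBijective _ (TableauChain.bijective_extend hν))).symm

theorem dimSkew_bot_of_card_eq_zero (ν : YoungDiagram) (hν : ν.card = 0) :
    dimSkew ⊥ ν = 1 := by
  obtain rfl : ν = ⊥ := YoungDiagram.ext (by
    rw [Finset.card_eq_zero.1 hν, YoungDiagram.cells_bot])
  rw [dimSkew_bot, Nat.card_eq_one_iff_unique]
  refine ⟨⟨fun c c' => Subtype.ext (funext fun i => ?_)⟩,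
    ⟨⟨fun _ => ⊥, rfl, fun i hi => ?_, fun _ _ => rfl⟩⟩⟩
  · rw [c.2.2.2 i (by omega), c'.2.2.2 i (by omega)]
  · omega

/-- The indices of the columns of `ν` from which a box can be removed. -/
abbrev CornerColumn (ν : YoungDiagram) (n : ℕ) : Type :=
  {i : Fin n // ν.colLen (i + 1) < ν.colLen i}

theorem YoungDiagram.rowLen_zero_mono {μ ν : YoungDiagram} (h : μ ≤ ν) :
    μ.rowLen 0 ≤ ν.rowLen 0 := by
  rw [← colLen_eq_zero_iff, ← Nat.le_zero]
  refine (le_iff_colLen_le.1 h _).trans ?_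
  rw [colLen_eq_zero_iff.2 le_rfl]

theorem exists_lowerDiagram (ν : YoungDiagram) {n : ℕ} (hn : ν.rowLen 0 ≤ n)
    (i : CornerColumn ν n) :
    ∃ μ : LowerDiagram ν, ∀ j : ℕ,
      μ.1.colLen j = Function.update ν.colLen (i.1 : ℕ) (ν.colLen i.1 - 1) j := by
  obtain ⟨⟨i, hin⟩, hi⟩ := i
  simp only at hi ⊢
  have hle : ∀ j, Function.update ν.colLen i (ν.colLen i - 1) j ≤ ν.colLen j := by
    intro j
    by_cases hj : j = i
    · subst hj; simp
    · simp [hj]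
  have hanti : Antitone (Function.update ν.colLen i (ν.colLen i - 1)) := by
    refine antitone_nat_of_succ_le fun j => ?_
    by_cases hj : j = i
    · subst hj
      simp only [Function.update_self, ne_eq, Nat.succ_ne_self, not_false_eq_true,
        Function.update_of_ne]
      omega
    · rw [Function.update_of_ne hj]
      exact (hle _).trans (ν.colLen_anti _ _ (Nat.le_succ j))
  obtain ⟨μ, hμ⟩ := YoungDiagram.exists_colLen_eq _ hanti (ν.rowLen 0) (by
    exact Nat.le_zero.1 ((hle _).trans_eq (YoungDiagram.colLen_eq_zero_iff.2 le_rfl)))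
  have hμν : μ ≤ ν := YoungDiagram.le_iff_colLen_le.2 fun j => (hμ j).trans_le (hle j)
  refine ⟨⟨μ, hμν, ?_⟩, hμ⟩
  rw [μ.card_eq_sum_colLen ((YoungDiagram.rowLen_zero_mono hμν).trans hn),
    ν.card_eq_sum_colLen hn, ← Finset.add_sum_erase _ _ (Finset.mem_univ (⟨i, hin⟩ : Fin n)),
    ← Finset.add_sum_erase _ _ (Finset.mem_univ (⟨i, hin⟩ : Fin n))]
  have : ∑ x ∈ Finset.univ.erase (⟨i, hin⟩ : Fin n), μ.colLen x =
      ∑ x ∈ Finset.univ.erase (⟨i, hin⟩ : Fin n), ν.colLen x := by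
    refine Finset.sum_congr rfl fun x hx => ?_
    rw [hμ, Function.update_of_ne]
    exact fun h => (Finset.ne_of_mem_erase hx) (Fin.ext h)
  rw [this]
  simp only [hμ, Function.update_self]
  omega

theorem exists_cornerColumn (ν : YoungDiagram) {n : ℕ} (hn : ν.rowLen 0 ≤ n)
    (μ : LowerDiagram ν) :
    ∃ i : CornerColumn ν n, ∀ j : ℕ,
      μ.1.colLen j = Function.update ν.colLen (i.1 : ℕ) (ν.colLen i.1 - 1) j := by
  obtain ⟨μ, hle, hcard⟩ := μ
  have hcol := YoungDiagram.le_iff_colLen_le.1 hle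
  rw [μ.card_eq_sum_colLen ((YoungDiagram.rowLen_zero_mono hle).trans hn),
    ν.card_eq_sum_colLen hn] at hcard
  obtain ⟨i, hi⟩ : ∃ i : Fin n, μ.colLen i < ν.colLen i := by
    by_contra! h
    have := Finset.sum_le_sum fun (i : Fin n) (_ : i ∈ Finset.univ) => h i
    omega
  have hsum := Finset.sum_erase_add _ (fun j : Fin n => μ.colLen j) (Finset.mem_univ i)
  have hsum' := Finset.sum_erase_add _ (fun j : Fin n => ν.colLen j) (Finset.mem_univ i)
  have hle' : ∑ j ∈ Finset.univ.erase i, μ.colLen j ≤ ∑ j ∈ Finset.univ.erase i, ν.colLen j :=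
    Finset.sum_le_sum fun j _ => hcol j
  have heq : ∀ j : ℕ, j ≠ i → μ.colLen j = ν.colLen j := by
    intro j hj
    by_cases hjn : j < n
    · refine (Finset.sum_eq_sum_iff_of_le fun (j : Fin n) _ => hcol j).1
        (le_antisymm hle' (by omega)) ⟨j, hjn⟩ (Finset.mem_erase.2 ⟨?_, Finset.mem_univ _⟩)
      exact fun h => hj (congrArg Fin.val h)
    · have := YoungDiagram.colLen_eq_zero_iff.2 (hn.trans (not_lt.1 hjn))
      have := hcol j
      omega
  refine ⟨⟨i, ?_⟩, fun j => ?_⟩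
  · rw [← heq (i + 1) (by omega)]
    exact (μ.colLen_anti _ _ (Nat.le_succ _)).trans_lt hi
  · by_cases hj : j = i
    · subst hj
      simp only [Function.update_self]
      omega
    · rw [Function.update_of_ne hj, heq j hj]

theorem columnDet_lower_eq_zero (ν : YoungDiagram) {n : ℕ} (hn : ν.rowLen 0 ≤ n) (i : Fin n)
    (hi : ¬ ν.colLen (i + 1) < ν.colLen i) :
    columnDet (Function.update (fun i : Fin n => (ν.colLen i : ℤ)) i
      ((ν.colLen i : ℤ) - 1)) = 0 := by
  have heq : ν.colLen (i + 1) = ν.colLen i :=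
    le_antisymm (ν.colLen_anti _ _ (Nat.le_succ _)) (not_lt.1 hi)
  by_cases h : (i : ℕ) + 1 < n
  · refine columnDet_eq_zero_of_not_injective _ fun hinj => ?_
    have hne : (⟨i + 1, h⟩ : Fin n) ≠ i := fun h' => Nat.succ_ne_self _ (congrArg Fin.val h')
    refine hne (hinj ?_)
    simp only [Function.update_of_ne hne, Function.update_self, heq]
    push_cast
    ring
  · cases n with
    | zero => exact i.elim0
    | succ n =>
      obtain rfl : i = Fin.last n := Fin.ext (by have := i.is_lt; rw [Fin.val_last]; omega)
      refine columnDet_eq_zero_of_last_neg _ ?_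
      rw [Fin.val_last] at heq
      have : ν.colLen (n + 1) = 0 := YoungDiagram.colLen_eq_zero_iff.2 hn
      simp only [Function.update_self, Fin.val_last]
      omega

theorem sum_lowerDiagram (ν : YoungDiagram) {n : ℕ} (hn : ν.rowLen 0 ≤ n)
    [Fintype (LowerDiagram ν)] :
    ∑ μ : LowerDiagram ν, expSpec (SchurF μ.1) =
      ∑ i : Fin n, expSpec (columnDet (Function.update (fun i : Fin n => (ν.colLen i : ℤ)) i
        ((ν.colLen i : ℤ) - 1))) := by
  choose m hm using exists_lowerDiagram ν hn
  have hbij : Function.Bijective m := by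
    refine ⟨fun i i' h => ?_, fun μ => ?_⟩
    · by_contra hne
      have h1 := hm i i.1
      have h2 := hm i' i.1
      rw [← h, h1, Function.update_self, Function.update_of_ne] at h2
      · have := i.2
        omega
      · exact fun h' => hne (Subtype.ext (Fin.ext h'))
    · obtain ⟨i, hi⟩ := exists_cornerColumn ν hn μ
      exact ⟨i, Subtype.ext (YoungDiagram.ext_colLen fun j => by rw [hm, hi])⟩
  rw [← Fintype.sum_bijective m hbij (fun i => expSpec (columnDet (Function.update
    (fun i : Fin n => (ν.colLen i : ℤ)) i.1 ((ν.colLen i.1 : ℤ) - 1)))) _ fun i => ?_]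
  · have hfilter := Finset.sum_filter_of_ne
      (s := Finset.univ) (p := fun i : Fin n => ν.colLen (i + 1) < ν.colLen i)
      (f := fun i => expSpec (columnDet (Function.update (fun i : Fin n => (ν.colLen i : ℤ)) i
        ((ν.colLen i : ℤ) - 1)))) (fun i _ hi => by
          by_contra h
          exact hi (by rw [columnDet_lower_eq_zero ν hn i h, map_zero]))
    rw [← hfilter, ← Finset.sum_subtype_eq_sum_filter]
    refine Finset.sum_congr ?_ fun _ _ => rfl
    ext i
    simp
  · rw [SchurF_eq_columnDet _ ((YoungDiagram.rowLen_zero_mono (m i).2.1).trans hn)]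
    congr 2
    ext j
    rw [hm]
    by_cases hj : j = i.1
    · subst hj
      have := i.2
      simp only [Function.update_self]
      omega
    · rw [Function.update_of_ne hj, Function.update_of_ne fun h => hj (Fin.ext h)]

theorem dimSkew_bot_eq_expSpec (ν : YoungDiagram) :
    (dimSkew ⊥ ν : ℂ) = (ν.card.factorial : ℂ) * expSpec (SchurF ν) := by
  induction h : ν.card generalizing ν with
  | zero =>
    have hrow : ν.rowLen 0 ≤ 0 := by
      obtain rfl : ν = ⊥ := YoungDiagram.ext (by
        rw [Finset.card_eq_zero.1 h, YoungDiagram.cells_bot])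
      rw [← YoungDiagram.colLen_eq_zero_iff, YoungDiagram.colLen_eq_card, YoungDiagram.col]
      simp
    rw [dimSkew_bot_of_card_eq_zero ν h, SchurF_eq_columnDet ν hrow, columnDet_fin_zero]
    simp
  | succ m ih =>
    have := Fintype.ofFinite (LowerDiagram ν)
    rw [dimSkew_bot_eq_sum ν (by omega)]
    push_cast
    rw [Finset.sum_congr rfl fun μ _ => ih μ.1 (by have := μ.2.2; omega), ← Finset.mul_sum,
      sum_lowerDiagram ν le_rfl, sum_expSpec_columnDet_lower, ← SchurF_eq_columnDet ν le_rfl]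
    have hcard := ν.card_eq_sum_colLen le_rfl
    rw [h] at hcard
    have : (∑ i : Fin (ν.rowLen 0), (((ν.colLen i : ℕ) : ℤ) : ℂ)) = ((m + 1 : ℕ) : ℂ) := by
      rw [hcard]
      push_cast
      rfl
    rw [this, Nat.factorial_succ]
    push_cast
    ring

/-! ### Adding two long columns -/

theorem tendsto_intCast_add_div (w : ℂ) (k : ℤ) :
    Tendsto (fun s : ℤ => (w - s) / ((s : ℂ) + k)) atTop (𝓝 (-1)) := by
  have hinv : Tendsto (fun s : ℤ => ((s : ℂ) + k)⁻¹) atTop (𝓝 0) := by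
    refine tendsto_inv₀_cobounded.comp ?_
    rw [← tendsto_norm_atTop_iff_cobounded]
    have : Tendsto (fun s : ℤ => |((s + k : ℤ) : ℝ)|) atTop atTop :=
      tendsto_abs_atTop_atTop.comp
        (tendsto_intCast_atTop_atTop.comp (tendsto_atTop_add_const_right _ k tendsto_id))
    refine this.congr fun s => ?_
    rw [← Complex.norm_intCast]
    push_cast
    rfl
  have h : Tendsto (fun s : ℤ => (w + k) * ((s : ℂ) + k)⁻¹ - 1) atTop (𝓝 ((w + k) * 0 - 1)) :=
    (hinv.const_mul _).sub_const 1
  rw [mul_zero, zero_sub] at h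
  refine h.congr' ?_
  filter_upwards [eventually_gt_atTop (-k)] with s hs
  have : ((s : ℂ) + k) ≠ 0 := by
    have : (s + k : ℤ) ≠ 0 := by omega
    exact_mod_cast this
  field_simp
  ring

theorem tendsto_invFact_succ_div :
    Tendsto (fun s : ℤ => invFact (s + 1) / invFact s) atTop (𝓝 0) := by
  have hinv : Tendsto (fun s : ℤ => (((s + 1 : ℤ) : ℂ))⁻¹) atTop (𝓝 0) := by
    refine tendsto_inv₀_cobounded.comp ?_
    rw [← tendsto_norm_atTop_iff_cobounded]
    have : Tendsto (fun s : ℤ => |((s + 1 : ℤ) : ℝ)|) atTop atTop :=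
      tendsto_abs_atTop_atTop.comp
        (tendsto_intCast_atTop_atTop.comp (tendsto_atTop_add_const_right _ 1 tendsto_id))
    exact this.congr fun s => (Complex.norm_intCast _).symm
  refine hinv.congr' ?_
  filter_upwards [eventually_ge_atTop 0] with s hs
  have h1 := invFact_sub_one (s + 1)
  rw [add_sub_cancel_right] at h1
  have h2 : invFact (s + 1) ≠ 0 := invFact_ne_zero (by omega)
  have h3 : (((s + 1 : ℤ) : ℂ)) ≠ 0 := Int.cast_ne_zero.2 (by omega)
  rw [h1]
  field_simp

theorem tendsto_invFact_succ_div_add (k : ℤ) :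
    Tendsto (fun s : ℤ => invFact (s + k + 1) / invFact (s + k)) atTop (𝓝 0) :=
  tendsto_invFact_succ_div.comp (tendsto_atTop_add_const_right _ k tendsto_id)

theorem addColumn_addColumn_one (a b : ℤ) :
    addColumn a (addColumn b 1) = eGen a * eGen b - eGen (a + 1) * eGen (b - 1) := by
  rw [addColumn_one, ← mul_one (eGen b), addColumn_eGen_mul, addColumn_one, addColumn_one]
  ring

/-- The order of growth of the exponential specialization of a diagram with two long columns
of lengths `s + δ` and `s`. -/
noncomputable def twoColumnScale (δ s : ℤ) : ℂ := invFact (s + δ + 1) * invFact s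

theorem tendsto_expSpec_addColumn_addColumn (F : MvPolynomial ℕ ℂ) (δ : ℤ) :
    Tendsto (fun s : ℤ => expSpec (addColumn (s + δ) (addColumn s F)) / twoColumnScale δ s)
      atTop (𝓝 ((δ + 1) * expSpec F)) := by
  induction F using MvPolynomial.induction_on generalizing δ with
  | C a =>
    rw [← mul_one (MvPolynomial.C a), ← MvPolynomial.smul_eq_C_mul]
    refine Tendsto.congr' ?_ tendsto_const_nhds
    filter_upwards [eventually_ge_atTop 0, eventually_ge_atTop (-δ)] with s hs hs'
    have h1 : invFact s ≠ 0 := invFact_ne_zero hs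
    have h2 : invFact (s + δ + 1) ≠ 0 := invFact_ne_zero (by omega)
    have h3 := invFact_sub_one (s + δ + 1)
    rw [add_sub_cancel_right] at h3
    simp only [map_smul, addColumn_addColumn_one, map_sub, map_mul, expSpec_eGen, twoColumnScale,
      map_one, smul_eq_mul, mul_one]
    rw [h3, invFact_sub_one]
    field_simp
    push_cast
    ring
  | add p q hp hq =>
    simp only [map_add, mul_add, add_div]
    exact (hp δ).add (hq δ)
  | mul_X p i hp =>
    rw [mul_comm p, ← eGen_natCast_succ]
    generalize (i : ℤ) + 1 = k
    have hA := (hp δ).const_mul (invFact k)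
    have hB := ((hp (δ + 1)).mul (tendsto_invFact_succ_div_add (δ + 1))).const_mul
      (invFact (k - 1))
    have hC := (((hp (δ - 1)).comp (tendsto_atTop_add_const_right _ 1 tendsto_id)).mul
      tendsto_invFact_succ_div).const_mul (invFact (k - 1))
    have hD := (((hp δ).comp (tendsto_atTop_add_const_right _ 1 tendsto_id)).mul
      ((tendsto_invFact_succ_div_add (δ + 1)).mul tendsto_invFact_succ_div)).const_mul
      (invFact (k - 2))
    have h := ((hA.sub hB).sub hC).add hD
    simp only [mul_zero, sub_zero, add_zero] at h
    rw [map_mul, expSpec_eGen, mul_left_comm]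
    refine h.congr' ?_
    filter_upwards [eventually_ge_atTop 0, eventually_ge_atTop (-δ)] with s hs hs'
    have h1 : invFact s ≠ 0 := invFact_ne_zero hs
    have h2 : invFact (s + δ + 1) ≠ 0 := invFact_ne_zero (by omega)
    have h3 : invFact (s + 1) ≠ 0 := invFact_ne_zero (by omega)
    have h4 : invFact (s + δ + 1 + 1) ≠ 0 := invFact_ne_zero (by omega)
    simp only [Function.comp_apply, id_eq, addColumn_addColumn_eGen_mul, map_sub, map_add, map_mul,
      expSpec_eGen, twoColumnScale]
    rw [show s + 1 + (δ - 1) = s + δ by ring, show s + (δ + 1) = s + δ + 1 by ring,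
      show s + 1 + δ = s + δ + 1 by ring]
    field_simp

theorem tendsto_shift_div {f : ℤ → ℂ} (hf : ∀ᶠ s in atTop, f s ≠ 0)
    (h : Tendsto (fun s => f (s + 1) / f s) atTop (𝓝 1)) (k : ℤ) :
    Tendsto (fun s => f (s + k) / f s) atTop (𝓝 1) := by
  have hsh : ∀ k : ℤ, Tendsto (fun s : ℤ => s + k) atTop atTop := fun k =>
    tendsto_atTop_add_const_right _ k tendsto_id
  have hnat : ∀ n : ℕ, Tendsto (fun s => f (s + n) / f s) atTop (𝓝 1) := by
    intro n
    induction n with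
    | zero =>
      refine Tendsto.congr' ?_ tendsto_const_nhds
      filter_upwards [hf] with s hs
      simp [hs]
    | succ n ih =>
      have := (h.comp (hsh n)).mul ih
      rw [mul_one] at this
      refine this.congr' ?_
      filter_upwards [(hsh n).eventually hf, hf] with s hs hs'
      simp only [Function.comp_apply]
      push_cast
      rw [← add_assoc]
      field_simp
  obtain ⟨n, rfl | rfl⟩ := k.eq_nat_or_neg
  · exact hnat n
  · have := ((hnat n).comp (hsh (-n))).inv₀ one_ne_zero
    rw [inv_one] at this
    refine this.congr fun s => ?_
    simp only [Function.comp_apply, neg_add_cancel_right, inv_div]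

/-- The content product of a single column of length `a`. -/
noncomputable def colContent (z z' : ℂ) (a : ℤ) : ℂ :=
  ∏ t ∈ Finset.range a.toNat, (z - t) * (z' - t)

/-- The normalization of the functional on diagrams with two long columns. -/
noncomputable def laguerreScale (z z' : ℂ) (s : ℤ) : ℂ :=
  (colContent z z' s * invFact (s + 1) ^ 2) * (colContent (z + 1) (z' + 1) s * invFact s ^ 2)

/-- A complex number which is not an integer. -/
def NonInteger (z : ℂ) : Prop := ∀ n : ℤ, z ≠ n

theorem NonInteger.add_one {z : ℂ} (hz : NonInteger z) : NonInteger (z + 1) := by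
  intro n h
  refine hz (n - 1) ?_
  push_cast
  rw [← h]
  ring

theorem colContent_ne_zero {z z' : ℂ} (hz : NonInteger z) (hz' : NonInteger z') (a : ℤ) :
    colContent z z' a ≠ 0 := by
  refine Finset.prod_ne_zero_iff.2 fun t _ => mul_ne_zero ?_ ?_
  · exact sub_ne_zero.2 (by exact_mod_cast hz t)
  · exact sub_ne_zero.2 (by exact_mod_cast hz' t)

theorem colContent_add_one (z z' : ℂ) {a : ℤ} (ha : 0 ≤ a) :
    colContent z z' (a + 1) = colContent z z' a * ((z - a) * (z' - a)) := by
  obtain ⟨a, rfl⟩ := Int.eq_ofNat_of_zero_le ha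
  rw [colContent, show ((a : ℤ) + 1).toNat = a + 1 by omega, Finset.prod_range_succ, colContent]
  simp

theorem tendsto_colContent_mul_succ_div {z z' : ℂ} (hz : NonInteger z) (hz' : NonInteger z')
    {k : ℤ} (hk : 0 ≤ k) :
    Tendsto (fun s : ℤ => (colContent z z' (s + 1) * invFact (s + 1 + k) ^ 2) /
      (colContent z z' s * invFact (s + k) ^ 2)) atTop (𝓝 1) := by
  have h := (tendsto_intCast_add_div z (k + 1)).mul (tendsto_intCast_add_div z' (k + 1))
  rw [neg_mul_neg, one_mul] at h
  refine h.congr' ?_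
  filter_upwards [eventually_ge_atTop 0] with s hs
  have h0 := colContent_ne_zero hz hz' s
  have h1 := invFact_sub_one (s + 1 + k)
  have h2 : invFact (s + 1 + k) ≠ 0 := invFact_ne_zero (by omega)
  have h3 : (s : ℂ) + 1 + k ≠ 0 := by
    have : (s + 1 + k : ℤ) ≠ 0 := by omega
    exact_mod_cast this
  have h4 : (s : ℂ) + ((k + 1 : ℤ) : ℂ) = (s : ℂ) + 1 + k := by push_cast; ring
  rw [show s + 1 + k - 1 = s + k by ring] at h1
  rw [h1, colContent_add_one z z' hs, h4]
  push_cast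
  field_simp

theorem eventually_colContent_mul_ne_zero {z z' : ℂ} (hz : NonInteger z) (hz' : NonInteger z')
    {k : ℤ} (hk : 0 ≤ k) :
    ∀ᶠ s : ℤ in atTop, colContent z z' s * invFact (s + k) ^ 2 ≠ 0 := by
  filter_upwards [eventually_ge_atTop 0] with s hs
  exact mul_ne_zero (colContent_ne_zero hz hz' s) (pow_ne_zero 2 (invFact_ne_zero (by omega)))

theorem tendsto_colContent_mul_shift_div {z z' : ℂ} (hz : NonInteger z) (hz' : NonInteger z')
    {k : ℤ} (hk : 0 ≤ k) (j : ℤ) :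
    Tendsto (fun s : ℤ => (colContent z z' (s + j) * invFact (s + j + k) ^ 2) /
      (colContent z z' s * invFact (s + k) ^ 2)) atTop (𝓝 1) :=
  tendsto_shift_div (f := fun s => colContent z z' s * invFact (s + k) ^ 2)
    (eventually_colContent_mul_ne_zero hz hz' hk) (tendsto_colContent_mul_succ_div hz hz' hk) j

theorem eventually_laguerreScale_ne_zero {z z' : ℂ} (hz : NonInteger z) (hz' : NonInteger z') :
    ∀ᶠ s : ℤ in atTop, laguerreScale z z' s ≠ 0 := by
  filter_upwards [eventually_colContent_mul_ne_zero hz hz' zero_le_one,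
    eventually_colContent_mul_ne_zero hz.add_one hz'.add_one le_rfl] with s h1 h2
  rw [add_zero] at h2
  exact mul_ne_zero h1 h2

theorem tendsto_laguerreScale_shift_div {z z' : ℂ} (hz : NonInteger z) (hz' : NonInteger z')
    (j : ℤ) :
    Tendsto (fun s : ℤ => laguerreScale z z' (s + j) / laguerreScale z z' s) atTop (𝓝 1) := by
  have h := (tendsto_colContent_mul_shift_div hz hz' zero_le_one j).mul
    (tendsto_colContent_mul_shift_div hz.add_one hz'.add_one le_rfl j)
  rw [one_mul] at h
  refine h.congr fun s => ?_
  rw [add_zero, add_zero, laguerreScale, laguerreScale]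
  exact (mul_div_mul_comm _ _ _ _).symm

/-- The values of the Laguerre functional on Schur functions, written through column lengths. -/
def IsLaguerreFunctional (z z' : ℂ) (ψ : MvPolynomial ℕ ℂ →ₗ[ℂ] ℂ) : Prop :=
  ∀ (n : ℕ) (l : Fin n → ℕ), Antitone l →
    ψ (columnDet fun i => (l i : ℤ)) =
      columnContent z z' l * expSpec (columnDet fun i => (l i : ℤ)) ^ 2

theorem isLaguerreFunctional_of_SchurF {z z' : ℂ} {ψ : MvPolynomial ℕ ℂ →ₗ[ℂ] ℂ}
    (hψ : ∀ ν : YoungDiagram, ψ (SchurF ν) =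
      contentProd z z' ν.cells * ((dimSkew ⊥ ν : ℂ) / (Nat.factorial ν.card : ℂ)) ^ 2) :
    IsLaguerreFunctional z z' ψ := by
  intro n l hl
  obtain ⟨ν, hn, hν⟩ := exists_youngDiagram_of_antitone l hl
  have h := hψ ν
  rw [dimSkew_bot_eq_expSpec, mul_div_cancel_left₀ _ (Nat.cast_ne_zero.2
    (Nat.factorial_ne_zero _)), contentProd_cells z z' ν hn, SchurF_eq_columnDet ν hn] at h
  simpa only [hν] using h

theorem IsLaguerreFunctional.map_one {z z' : ℂ} {ψ : MvPolynomial ℕ ℂ →ₗ[ℂ] ℂ}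
    (hψ : IsLaguerreFunctional z z' ψ) : ψ 1 = 1 := by
  have := hψ 0 Fin.elim0 (fun i => i.elim0)
  simpa [columnDet_fin_zero, columnContent] using this

theorem antitone_cons {n : ℕ} {a : ℕ} {l : Fin n → ℕ} (hl : Antitone l) (h : ∀ i, l i ≤ a) :
    Antitone (Fin.cons a l : Fin (n + 1) → ℕ) := by
  intro i j hij
  refine Fin.cases (fun _ => ?_) (fun i hij => ?_) i hij
  · refine Fin.cases ?_ (fun j => ?_) j
    · simp
    · simpa using h j
  · revert hij
    refine Fin.cases (fun h => ?_) (fun j h => ?_) j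
    · exact absurd h (by simp)
    · simpa using hl (Fin.succ_le_succ_iff.1 h)

theorem IsLaguerreFunctional.map_addColumn_addColumn {z z' : ℂ}
    {ψ : MvPolynomial ℕ ℂ →ₗ[ℂ] ℂ} (hψ : IsLaguerreFunctional z z' ψ) {n : ℕ} {l : Fin n → ℕ}
    (hl : Antitone l) {a b : ℤ} (hab : b ≤ a) (hb : ∀ i, (l i : ℤ) ≤ b) (hb0 : 0 ≤ b) :
    ψ (addColumn a (addColumn b (columnDet fun i => (l i : ℤ)))) =
      colContent z z' a * colContent (z + 1) (z' + 1) b * columnContent (z + 2) (z' + 2) l *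
        expSpec (addColumn a (addColumn b (columnDet fun i => (l i : ℤ)))) ^ 2 := by
  obtain ⟨b, rfl⟩ := Int.eq_ofNat_of_zero_le hb0
  obtain ⟨a, rfl⟩ := Int.eq_ofNat_of_zero_le (hb0.trans hab)
  have h1 : Antitone (Fin.cons b l : Fin (n + 1) → ℕ) :=
    antitone_cons hl fun i => by exact_mod_cast hb i
  have h2 : Antitone (Fin.cons a (Fin.cons b l : Fin (n + 1) → ℕ) : Fin (n + 2) → ℕ) :=
    antitone_cons h1 fun i => by
      refine (h1 (Fin.zero_le i)).trans ?_
      simpa using hab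
  have hcast : (fun i => ((Fin.cons a (Fin.cons b l : Fin (n + 1) → ℕ) : Fin (n + 2) → ℕ) i : ℤ))
      = Fin.cons (a : ℤ) (Fin.cons (b : ℤ) fun i => (l i : ℤ) : Fin (n + 1) → ℤ) := by
    ext i
    refine Fin.cases ?_ (fun i => Fin.cases ?_ (fun i => ?_) i) i <;> simp
  have h := hψ _ _ h2
  rw [hcast, columnDet_cons, columnDet_cons, columnContent_cons, columnContent_cons] at h
  rw [h, colContent, colContent, Int.toNat_natCast, Int.toNat_natCast,
    show z + 1 + 1 = z + 2 by ring, show z' + 1 + 1 = z' + 2 by ring, ← mul_assoc]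

/-- The limit profile of a Laguerre functional on two long columns whose lengths differ
by `δ`. -/
noncomputable def gapProfile (δ : ℤ) : ℂ := ((δ + 1) * |δ + 1| : ℤ)

theorem IsLaguerreFunctional.tendsto_columnDet_of_nonneg {z z' : ℂ} (hz : NonInteger z)
    (hz' : NonInteger z') {ψ : MvPolynomial ℕ ℂ →ₗ[ℂ] ℂ} (hψ : IsLaguerreFunctional z z' ψ)
    {n : ℕ} {l : Fin n → ℕ} (hl : Antitone l) {δ : ℤ} (hδ : 0 ≤ δ) :
    Tendsto (fun s : ℤ => ψ (addColumn (s + δ) (addColumn s (columnDet fun i => (l i : ℤ)))) /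
      laguerreScale z z' s) atTop (𝓝 (gapProfile δ *
        (columnContent (z + 2) (z' + 2) l * expSpec (columnDet fun i => (l i : ℤ)) ^ 2))) := by
  set F := columnDet fun i => (l i : ℤ) with hF
  have h1 := (tendsto_expSpec_addColumn_addColumn F δ).pow 2
  have h2 := tendsto_colContent_mul_shift_div hz hz' zero_le_one δ
  have h := (h1.mul h2).const_mul (columnContent (z + 2) (z' + 2) l)
  have hg : columnContent (z + 2) (z' + 2) l * ((((δ : ℂ) + 1) * expSpec F) ^ 2 * 1) =
      gapProfile δ * (columnContent (z + 2) (z' + 2) l * expSpec F ^ 2) := by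
    rw [gapProfile, abs_of_nonneg (by omega)]
    push_cast
    ring
  rw [hg] at h
  refine h.congr' ?_
  have hl0 : ∀ᶠ s : ℤ in atTop, ∀ i, (l i : ℤ) ≤ s :=
    eventually_all.2 fun i => eventually_ge_atTop _
  filter_upwards [hl0, eventually_ge_atTop 0] with s hs hs0
  rw [hψ.map_addColumn_addColumn hl (by omega) hs hs0, ← hF, laguerreScale, twoColumnScale]
  have i1 : invFact s ≠ 0 := invFact_ne_zero hs0
  have i2 : invFact (s + δ + 1) ≠ 0 := invFact_ne_zero (by omega)
  have i3 : invFact (s + 1) ≠ 0 := invFact_ne_zero (by omega)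
  have c1 := colContent_ne_zero hz hz' s
  have c2 := colContent_ne_zero hz.add_one hz'.add_one s
  field_simp

theorem gapProfile_neg_sub_two (δ : ℤ) : gapProfile (-δ - 2) = - gapProfile δ := by
  rw [gapProfile, gapProfile, show -δ - 2 + 1 = -(δ + 1) by ring, abs_neg]
  push_cast
  ring

theorem IsLaguerreFunctional.tendsto_columnDet {z z' : ℂ} (hz : NonInteger z)
    (hz' : NonInteger z') {ψ : MvPolynomial ℕ ℂ →ₗ[ℂ] ℂ} (hψ : IsLaguerreFunctional z z' ψ)
    {n : ℕ} {l : Fin n → ℕ} (hl : Antitone l) (δ : ℤ) :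
    Tendsto (fun s : ℤ => ψ (addColumn (s + δ) (addColumn s (columnDet fun i => (l i : ℤ)))) /
      laguerreScale z z' s) atTop (𝓝 (gapProfile δ *
        (columnContent (z + 2) (z' + 2) l * expSpec (columnDet fun i => (l i : ℤ)) ^ 2))) := by
  rcases lt_trichotomy δ (-1) with hδ | rfl | hδ
  · have h := (((hψ.tendsto_columnDet_of_nonneg hz hz' hl (show 0 ≤ -δ - 2 by omega)).comp
      (tendsto_atTop_add_const_right _ (δ + 1) tendsto_id)).mul
        (tendsto_laguerreScale_shift_div hz hz' (δ + 1))).neg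
    rw [gapProfile_neg_sub_two, mul_one, neg_mul, neg_neg] at h
    refine h.congr' ?_
    filter_upwards [(tendsto_atTop_add_const_right _ (δ + 1) tendsto_id).eventually
      (eventually_laguerreScale_ne_zero hz hz')] with s hs
    simp only [Function.comp_apply, id_eq] at hs ⊢
    rw [addColumn_swap (s + δ) s, map_neg, show s + (δ + 1) + (-δ - 2) = s - 1 by ring,
      ← add_assoc] at *
    field_simp
  · have h0 : gapProfile (-1) = 0 := by simp [gapProfile]
    rw [h0, zero_mul]
    refine tendsto_const_nhds.congr fun s => ?_
    have := addColumn_swap (s + -1) s (columnDet fun i => (l i : ℤ))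
    rw [show s + -1 + 1 = s by ring, ← sub_eq_add_neg, self_eq_neg] at this
    rw [← sub_eq_add_neg, this, map_zero, zero_div]
  · exact hψ.tendsto_columnDet_of_nonneg hz hz' hl (by omega)

/-- The functional obtained from a Laguerre functional by removing two long columns is a
Laguerre functional with parameters shifted by two. -/
theorem IsLaguerreFunctional.exists_limit {z z' : ℂ} (hz : NonInteger z)
    (hz' : NonInteger z') {ψ : MvPolynomial ℕ ℂ →ₗ[ℂ] ℂ} (hψ : IsLaguerreFunctional z z' ψ) :
    ∃ φ : MvPolynomial ℕ ℂ →ₗ[ℂ] ℂ, IsLaguerreFunctional (z + 2) (z' + 2) φ ∧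
      ∀ (F : MvPolynomial ℕ ℂ) (δ : ℤ),
        Tendsto (fun s : ℤ => ψ (addColumn (s + δ) (addColumn s F)) / laguerreScale z z' s)
          atTop (𝓝 (gapProfile δ * φ F)) := by
  have hind : ∀ {p : MvPolynomial ℕ ℂ → Prop},
      (∀ (n : ℕ) (l : Fin n → ℕ), Antitone l → p (columnDet fun i => (l i : ℤ))) →
      p 0 → (∀ x y, p x → p y → p (x + y)) → (∀ (t : ℂ) x, p x → p (t • x)) → ∀ F, p F := by
    intro p h1 h2 h3 h4 F
    have hF : F ∈ Submodule.span ℂ (Set.range fun p : Σ n, {l : Fin n → ℕ // Antitone l} =>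
        columnDet fun i => (p.2.1 i : ℤ)) := by
      rw [span_range_columnDet_antitone]; trivial
    induction hF using Submodule.span_induction with
    | mem x hx =>
      obtain ⟨⟨n, l, hl⟩, rfl⟩ := hx
      exact h1 n l hl
    | zero => exact h2
    | add x y _ _ hx hy => exact h3 x y hx hy
    | smul t x _ hx => exact h4 t x hx
  have hex : ∀ F : MvPolynomial ℕ ℂ, ∃ L : ℂ, ∀ δ : ℤ,
      Tendsto (fun s : ℤ => ψ (addColumn (s + δ) (addColumn s F)) / laguerreScale z z' s)
        atTop (𝓝 (gapProfile δ * L)) := by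
    refine hind (fun n l hl => ⟨_, hψ.tendsto_columnDet hz hz' hl⟩) ⟨0, ?_⟩ ?_ ?_
    · intro δ
      simp
    · rintro x y ⟨L, hL⟩ ⟨L', hL'⟩
      refine ⟨L + L', fun δ => ?_⟩
      simp only [map_add, mul_add, add_div]
      exact (hL δ).add (hL' δ)
    · rintro t x ⟨L, hL⟩
      refine ⟨t * L, fun δ => ?_⟩
      simp only [map_smul, smul_eq_mul, mul_left_comm _ t, mul_div_assoc]
      exact (hL δ).const_mul t
  choose φ hφ using hex
  have hg : gapProfile 0 = 1 := by simp [gapProfile]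
  have huniq : ∀ (F : MvPolynomial ℕ ℂ) (L : ℂ),
      Tendsto (fun s : ℤ => ψ (addColumn (s + 0) (addColumn s F)) / laguerreScale z z' s)
        atTop (𝓝 (gapProfile 0 * L)) → φ F = L := by
    intro F L hL
    have := tendsto_nhds_unique (hφ F 0) hL
    rwa [hg, one_mul, one_mul] at this
  refine ⟨{ toFun := φ, map_add' := fun x y => huniq _ _ ?_, map_smul' := fun t x => huniq _ _ ?_ },
    fun n l hl => huniq _ _ (hψ.tendsto_columnDet hz hz' hl 0), hφ⟩
  · simp only [map_add, mul_add, add_div]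
    exact (hφ x 0).add (hφ y 0)
  · simp only [map_smul, smul_eq_mul, RingHom.id_apply, mul_left_comm _ t, mul_div_assoc]
    exact (hφ x 0).const_mul t

/-! ### Asymptotics of products -/

section AddPair

open Polynomial

/-- The coefficients of the expansion in `q` of `E(q) / (1 - Xq + q²)`, where `E(q)` is the generating
series of the elementary symmetric functions. -/
noncomputable def addPairNat : ℕ → (MvPolynomial ℕ ℂ)[X]
  | 0 => 1
  | 1 => C (eGen 1) + X
  | k + 2 => C (eGen ((k : ℤ) + 2)) + X * addPairNat (k + 1) - addPairNat k

/-- The extension of `addPairNat` by zero to negative indices. -/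
noncomputable def addPairGen (k : ℤ) : (MvPolynomial ℕ ℂ)[X] :=
  if k < 0 then 0 else addPairNat k.toNat

theorem addPairGen_neg {k : ℤ} (hk : k < 0) : addPairGen k = 0 := by simp [addPairGen, hk]

@[simp] theorem addPairGen_zero : addPairGen 0 = 1 := by simp [addPairGen, addPairNat]

theorem addPairGen_eq (k : ℤ) :
    addPairGen k = C (eGen k) + X * addPairGen (k - 1) - addPairGen (k - 2) := by
  rcases lt_or_ge k 0 with hk | hk
  · rw [addPairGen_neg hk, eGen_neg hk, addPairGen_neg (show k - 1 < 0 by omega),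
      addPairGen_neg (show k - 2 < 0 by omega)]
    simp
  obtain ⟨k, rfl⟩ := Int.eq_ofNat_of_zero_le hk
  match k with
  | 0 => simp [addPairGen_neg]
  | 1 => simp [addPairGen, addPairNat]
  | k + 2 =>
    have h1 : ((k + 2 : ℕ) : ℤ) - 1 = ((k + 1 : ℕ) : ℤ) := by push_cast; ring
    have h2 : ((k + 2 : ℕ) : ℤ) - 2 = (k : ℤ) := by push_cast; ring
    have h3 : ∀ m : ℕ, addPairGen (m : ℤ) = addPairNat m := fun m => by simp [addPairGen]
    rw [h1, h2, h3, h3, h3, addPairNat]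
    push_cast
    rfl

/-- The algebra homomorphism multiplying the generating series of the elementary symmetric
functions by `1 / (1 - Xq + q²)`. -/
noncomputable def addPair : MvPolynomial ℕ ℂ →ₐ[ℂ] (MvPolynomial ℕ ℂ)[X] :=
  MvPolynomial.aeval fun j : ℕ => addPairGen ((j : ℤ) + 1)

theorem addPair_eGen (k : ℤ) : addPair (eGen k) = addPairGen k := by
  rcases lt_trichotomy k 0 with hk | rfl | hk
  · rw [eGen_neg hk, addPairGen_neg hk, map_zero]
  · simp
  · obtain ⟨j, rfl⟩ : ∃ j : ℕ, k = (j : ℤ) + 1 := ⟨(k - 1).toNat, by omega⟩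
    rw [eGen_natCast_succ, addPair, MvPolynomial.aeval_X]

/-- The operator `g ↦ g(· + 1) + g(· - 1)` on functions on the integers. -/
def shiftSum : (ℤ → ℂ) →ₗ[ℂ] (ℤ → ℂ) where
  toFun g δ := g (δ + 1) + g (δ - 1)
  map_add' f g := by ext δ; simp only [Pi.add_apply]; ring
  map_smul' t g := by ext δ; simp only [Pi.smul_apply, smul_eq_mul, RingHom.id_apply]; ring

theorem shiftSum_apply (g : ℤ → ℂ) (δ : ℤ) : shiftSum g δ = g (δ + 1) + g (δ - 1) := rfl

/-- The linear map `∑ c_k X^k ↦ ∑ φ(c_k) τ^k g`, where `τ` is `shiftSum`. -/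
noncomputable def evalShift (φ : MvPolynomial ℕ ℂ →ₗ[ℂ] ℂ) (g : ℤ → ℂ) :
    (MvPolynomial ℕ ℂ)[X] →ₗ[ℂ] (ℤ → ℂ) :=
  lsum fun k => (LinearMap.toSpanSingleton ℂ (ℤ → ℂ) ((shiftSum ^ k) g)) ∘ₗ φ

theorem evalShift_apply (φ : MvPolynomial ℕ ℂ →ₗ[ℂ] ℂ) (g : ℤ → ℂ)
    (P : (MvPolynomial ℕ ℂ)[X]) :
    evalShift φ g P = ∑ k ∈ P.support, φ (P.coeff k) • (shiftSum ^ k) g := by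
  simp [evalShift, lsum, Polynomial.sum]

theorem evalShift_monomial (φ : MvPolynomial ℕ ℂ →ₗ[ℂ] ℂ) (g : ℤ → ℂ) (k : ℕ)
    (c : MvPolynomial ℕ ℂ) :
    evalShift φ g (monomial k c) = φ c • (shiftSum ^ k) g := by
  simp [evalShift, lsum, sum_monomial_index]

theorem evalShift_X_mul (φ : MvPolynomial ℕ ℂ →ₗ[ℂ] ℂ) (g : ℤ → ℂ)
    (P : (MvPolynomial ℕ ℂ)[X]) : evalShift φ g (X * P) = shiftSum (evalShift φ g P) := by
  induction P using Polynomial.induction_on' with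
  | add p q hp hq => rw [mul_add, map_add, map_add, map_add, hp, hq]
  | monomial n c =>
    rw [X_mul_monomial, evalShift_monomial, evalShift_monomial, map_smul, pow_succ',
      Module.End.mul_apply]

theorem shiftSum_evalShift (φ : MvPolynomial ℕ ℂ →ₗ[ℂ] ℂ) (g : ℤ → ℂ)
    (P : (MvPolynomial ℕ ℂ)[X]) :
    shiftSum (evalShift φ g P) = evalShift φ (shiftSum g) P := by
  induction P using Polynomial.induction_on' with
  | add p q hp hq => rw [map_add, map_add, map_add, hp, hq]
  | monomial n c =>
    rw [evalShift_monomial, evalShift_monomial, map_smul, ← Module.End.mul_apply,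
      ← Module.End.mul_apply, ← pow_succ', ← pow_succ]

theorem shiftSum_gapProfile (δ : ℤ) (hδ : 0 ≤ δ) :
    shiftSum (shiftSum gapProfile) δ - 4 * shiftSum gapProfile δ + 4 * gapProfile δ =
      if δ = 0 then -2 else 0 := by
  simp only [shiftSum_apply, gapProfile]
  split_ifs with h
  · subst h
    norm_num
  · have habs : ∀ x : ℤ, δ - 1 ≤ x → |x| = x := fun x hx => abs_of_nonneg (by omega)
    rw [habs (δ + 1 + 1 + 1) (by omega), habs (δ + 1 - 1 + 1) (by omega),
      habs (δ - 1 + 1 + 1) (by omega), habs (δ - 1 - 1 + 1) (by omega),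
      habs (δ + 1 + 1) (by omega), habs (δ - 1 + 1) (by omega), habs (δ + 1) (by omega)]
    push_cast
    ring

theorem evalShift_eq_zero {φ : MvPolynomial ℕ ℂ →ₗ[ℂ] ℂ} {P : (MvPolynomial ℕ ℂ)[X]}
    (hP : evalShift φ gapProfile P = 0) (k : ℕ) : φ (P.coeff k) = 0 := by
  set h : ℤ → ℂ := shiftSum (shiftSum gapProfile) - (4 : ℂ) • shiftSum gapProfile +
    (4 : ℂ) • gapProfile with hh
  have hlin : ∀ (g₁ g₂ : ℤ → ℂ) (t : ℂ),
      evalShift φ (g₁ + t • g₂) P = evalShift φ g₁ P + t • evalShift φ g₂ P := by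
    intro g₁ g₂ t
    simp only [evalShift_apply, map_add, map_smul, smul_add, Finset.sum_add_distrib,
      Finset.smul_sum]
    congr 1
    exact Finset.sum_congr rfl fun k _ => smul_comm _ _ _
  have hzero : evalShift φ h P = 0 := by
    rw [hh, sub_eq_add_neg, ← neg_smul, hlin, hlin, ← shiftSum_evalShift, ← shiftSum_evalShift, hP]
    simp
  have hval : ∀ δ : ℤ, 0 ≤ δ → h δ = if δ = 0 then -2 else 0 := fun δ hδ => by
    rw [← shiftSum_gapProfile δ hδ]; rfl
  have hpow : ∀ (k : ℕ) (δ : ℤ), (k : ℤ) ≤ δ →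
      (shiftSum ^ k) h δ = if δ = k then -2 else 0 := by
    intro k
    induction k with
    | zero => intro δ hδ; simpa using hval δ (by simpa using hδ)
    | succ k ih =>
      intro δ hδ
      push_cast at hδ
      rw [pow_succ', Module.End.mul_apply, shiftSum_apply, ih _ (by omega), ih _ (by omega),
        if_neg (by omega), zero_add]
      by_cases hk : δ = k + 1
      · rw [if_pos (by omega), if_pos (by push_cast; omega)]
      · rw [if_neg (by omega), if_neg (by push_cast; omega)]
  by_contra hk
  have hne : (P.support.filter fun k => φ (P.coeff k) ≠ 0).Nonempty := by
    refine ⟨k, Finset.mem_filter.2 ⟨mem_support_iff.2 fun h0 => hk ?_, hk⟩⟩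
    rw [h0, map_zero]
  set K := (P.support.filter fun k => φ (P.coeff k) ≠ 0).max' hne with hK
  have hKmem := Finset.mem_filter.1 (Finset.max'_mem _ hne)
  rw [← hK] at hKmem
  have hev := congrFun hzero (K : ℤ)
  rw [evalShift_apply, Finset.sum_apply, Finset.sum_eq_single K] at hev
  · rw [Pi.smul_apply, hpow K K le_rfl, if_pos rfl, smul_eq_mul, Pi.zero_apply] at hev
    exact hKmem.2 (by simpa using hev)
  · intro j hj hjK
    rcases lt_or_gt_of_ne hjK with hlt | hgt
    · rw [Pi.smul_apply, hpow j K (by omega), if_neg (by omega), smul_zero]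
    · have : φ (P.coeff j) = 0 := by
        by_contra hne'
        have := Finset.le_max' _ j (Finset.mem_filter.2 ⟨hj, hne'⟩ :
          j ∈ P.support.filter fun k => φ (P.coeff k) ≠ 0)
        omega
      rw [this, zero_smul, Pi.zero_apply]
  · exact fun h => absurd hKmem.1 h

theorem tendsto_mul_addColumn_addColumn {z z' : ℂ} (hz : NonInteger z) (hz' : NonInteger z')
    {ψ φ : MvPolynomial ℕ ℂ →ₗ[ℂ] ℂ}
    (hφ : ∀ (F : MvPolynomial ℕ ℂ) (δ : ℤ),
      Tendsto (fun s : ℤ => ψ (addColumn (s + δ) (addColumn s F)) / laguerreScale z z' s)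
        atTop (𝓝 (gapProfile δ * φ F)))
    (f F : MvPolynomial ℕ ℂ) (δ : ℤ) :
    Tendsto (fun s : ℤ => ψ (f * addColumn (s + δ) (addColumn s F)) / laguerreScale z z' s)
      atTop (𝓝 (evalShift φ gapProfile (addPair f * C F) δ)) := by
  induction f using MvPolynomial.induction_on generalizing F δ with
  | C a =>
    have h1 : addPair (MvPolynomial.C a) * C F = a • monomial 0 F := by
      rw [← mul_one (MvPolynomial.C a), ← MvPolynomial.smul_eq_C_mul, map_smul, map_one,
        smul_mul_assoc, one_mul, monomial_zero_left]
    rw [h1, map_smul, evalShift_monomial, Pi.smul_apply, pow_zero, Module.End.one_apply,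
      Pi.smul_apply, smul_eq_mul, smul_eq_mul, mul_comm (φ F)]
    refine ((hφ F δ).const_mul a).congr fun s => ?_
    rw [← MvPolynomial.smul_eq_C_mul, map_smul, smul_eq_mul, mul_div_assoc]
  | add p q hp hq =>
    simp only [map_add, add_mul, add_div, Pi.add_apply]
    exact (hp F δ).add (hq F δ)
  | mul_X p i hp =>
    have key : ∀ (n : ℕ) (k : ℤ), k < n → ∀ (F : MvPolynomial ℕ ℂ) (δ : ℤ),
        Tendsto (fun s : ℤ => ψ (p * eGen k * addColumn (s + δ) (addColumn s F)) /
          laguerreScale z z' s)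
          atTop (𝓝 (evalShift φ gapProfile (addPair p * addPairGen k * C F) δ)) := by
      intro n
      induction n with
      | zero =>
        intro k hk F δ
        rw [Nat.cast_zero] at hk
        simp [eGen_neg hk, addPairGen_neg hk]
      | succ n ih =>
        intro k hk F δ
        push_cast at hk
        have hscale := tendsto_laguerreScale_shift_div hz hz' 1
        have hsh := tendsto_atTop_add_const_right atTop (1 : ℤ) (tendsto_id (α := ℤ))
        have hA := hp (eGen k * F) δ
        have hB := ih (k - 1) (by omega) F (δ + 1)
        have hC := ((ih (k - 1) (by omega) F (δ - 1)).comp hsh).mul hscale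
        have hD := ((ih (k - 2) (by omega) F δ).comp hsh).mul hscale
        have h := ((hA.add hB).add hC).sub hD
        have hlim : evalShift φ gapProfile (addPair p * addPairGen k * C F) δ =
            evalShift φ gapProfile (addPair p * C (eGen k * F)) δ +
            evalShift φ gapProfile (addPair p * addPairGen (k - 1) * C F) (δ + 1) +
            evalShift φ gapProfile (addPair p * addPairGen (k - 1) * C F) (δ - 1) * 1 -
            evalShift φ gapProfile (addPair p * addPairGen (k - 2) * C F) δ * 1 := by
          have : addPair p * addPairGen k * C F = addPair p * C (eGen k * F) +
              X * (addPair p * addPairGen (k - 1) * C F) -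
              addPair p * addPairGen (k - 2) * C F := by
            rw [addPairGen_eq k, C_mul]; ring
          rw [this, map_sub, map_add, evalShift_X_mul, Pi.sub_apply, Pi.add_apply,
            shiftSum_apply]
          ring
        rw [hlim]
        refine h.congr' ?_
        filter_upwards [hsh.eventually (eventually_laguerreScale_ne_zero hz hz')] with s hs
        simp only [Function.comp_apply, id_eq] at hs ⊢
        rw [show s + 1 + (δ - 1) = s + δ by ring, show s + (δ + 1) = s + δ + 1 by ring,
          show s + 1 + δ = s + δ + 1 by ring, div_mul_div_cancel₀ hs, div_mul_div_cancel₀ hs,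
          ← add_div, ← add_div, ← sub_div, ← map_add, ← map_add, ← map_sub]
        congr 2
        rw [addColumn_addColumn_eGen_mul]
        ring
    have hX := key (i + 2) ((i : ℤ) + 1) (by push_cast; omega) F δ
    have hpX : addPair (p * MvPolynomial.X i) = addPair p * addPairGen ((i : ℤ) + 1) := by
      rw [map_mul, ← eGen_natCast_succ, addPair_eGen]
    rw [hpX, ← eGen_natCast_succ]
    exact hX

theorem coeff_addPair_mem_ker {z z' : ℂ} (hz : NonInteger z) (hz' : NonInteger z')
    {ψ φ : MvPolynomial ℕ ℂ →ₗ[ℂ] ℂ}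
    (hφ : ∀ (F : MvPolynomial ℕ ℂ) (δ : ℤ),
      Tendsto (fun s : ℤ => ψ (addColumn (s + δ) (addColumn s F)) / laguerreScale z z' s)
        atTop (𝓝 (gapProfile δ * φ F)))
    {f : MvPolynomial ℕ ℂ} (hf : ∀ g, ψ (f * g) = 0) (k : ℕ) (F : MvPolynomial ℕ ℂ) :
    φ ((addPair f).coeff k * F) = 0 := by
  rw [← coeff_mul_C]
  refine evalShift_eq_zero (funext fun δ => ?_) k
  refine tendsto_nhds_unique (tendsto_mul_addColumn_addColumn hz hz' hφ f F δ) ?_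
  simp [hf]

end AddPair

/-! ### The weight filtration -/

section Weight

open Polynomial

/-- The weight of a monomial, where the generator `e_k` has weight `k`. -/
noncomputable def eWeight : (ℕ →₀ ℕ) →+ ℤ := Finsupp.weight fun i : ℕ => (i : ℤ) + 1

theorem eWeight_nonneg (m : ℕ →₀ ℕ) : 0 ≤ eWeight m := by
  rw [eWeight, Finsupp.weight_apply]
  exact Finsupp.sum_nonneg fun i _ => by positivity

/-- The polynomials all of whose monomials have weight at most `n`. -/
noncomputable def weightLE (n : ℤ) : Submodule ℂ (MvPolynomial ℕ ℂ) :=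
  MvPolynomial.restrictSupport ℂ {m | eWeight m ≤ n}

theorem mem_weightLE {n : ℤ} {f : MvPolynomial ℕ ℂ} :
    f ∈ weightLE n ↔ ∀ m ∈ f.support, eWeight m ≤ n := Iff.rfl

theorem weightLE_mono {a b : ℤ} (h : a ≤ b) : weightLE a ≤ weightLE b :=
  fun _ hf => mem_weightLE.2 fun m hm => (mem_weightLE.1 hf m hm).trans h

theorem eq_zero_of_mem_weightLE {n : ℤ} (hn : n < 0) {f : MvPolynomial ℕ ℂ}
    (hf : f ∈ weightLE n) : f = 0 := by
  by_contra h
  obtain ⟨m, hm⟩ := MvPolynomial.support_nonempty.2 h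
  linarith [eWeight_nonneg m, mem_weightLE.1 hf m hm]

theorem mul_mem_weightLE {a b : ℤ} {f g : MvPolynomial ℕ ℂ} (hf : f ∈ weightLE a)
    (hg : g ∈ weightLE b) : f * g ∈ weightLE (a + b) := by
  classical
  intro m hm
  obtain ⟨p, hp, q, hq, rfl⟩ := Finset.mem_add.1 (MvPolynomial.support_mul f g hm)
  rw [Set.mem_ofPred_eq, map_add]
  exact add_le_add (mem_weightLE.1 hf p hp) (mem_weightLE.1 hg q hq)

theorem one_mem_weightLE : (1 : MvPolynomial ℕ ℂ) ∈ weightLE 0 :=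
  (MvPolynomial.monomial_mem_restrictSupport ℂ (m := 0) (r := (1 : ℂ))).2 (Or.inl (by simp))

theorem eGen_mem_weightLE (k : ℤ) : eGen k ∈ weightLE k := by
  rcases lt_trichotomy k 0 with hk | rfl | hk
  · rw [eGen_neg hk]
    exact zero_mem _
  · rw [eGen_zero]
    exact one_mem_weightLE
  · obtain ⟨j, rfl⟩ : ∃ j : ℕ, k = (j : ℤ) + 1 := ⟨(k - 1).toNat, by omega⟩
    rw [eGen_natCast_succ]
    exact (MvPolynomial.monomial_mem_restrictSupport ℂ).2
      (Or.inl (by simp [eWeight, Finsupp.weight_single]))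

theorem exists_mem_weightLE (f : MvPolynomial ℕ ℂ) : ∃ n : ℕ, f ∈ weightLE n := by
  refine ⟨∑ m ∈ f.support, (eWeight m).toNat, fun m hm => ?_⟩
  have h := Finset.single_le_sum (f := fun m => (eWeight m).toNat) (fun _ _ => Nat.zero_le _) hm
  rw [Set.mem_ofPred_eq]
  exact (Int.self_le_toNat _).trans (by exact_mod_cast h)

/-- The polynomials of weight at most `n` when the variable is given weight one. -/
noncomputable def polyWeightLE (n : ℤ) : Submodule ℂ (MvPolynomial ℕ ℂ)[X] where
  carrier := {P | ∀ k : ℕ, P.coeff k ∈ weightLE (n - k)}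
  add_mem' hP hQ k := by
    rw [coeff_add]
    exact add_mem (hP k) (hQ k)
  zero_mem' k := by
    rw [coeff_zero]
    exact zero_mem _
  smul_mem' c P hP k := by
    rw [coeff_smul]
    exact Submodule.smul_mem _ c (hP k)

theorem polyWeightLE_mono {a b : ℤ} (h : a ≤ b) : polyWeightLE a ≤ polyWeightLE b :=
  fun _ hP k => weightLE_mono (by omega) (hP k)

theorem mul_mem_polyWeightLE {a b : ℤ} {P Q : (MvPolynomial ℕ ℂ)[X]} (hP : P ∈ polyWeightLE a)
    (hQ : Q ∈ polyWeightLE b) : P * Q ∈ polyWeightLE (a + b) := by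
  intro k
  rw [coeff_mul]
  refine Submodule.sum_mem _ fun x hx => ?_
  have h := mul_mem_weightLE (hP x.1) (hQ x.2)
  rw [Finset.HasAntidiagonal.mem_antidiagonal] at hx
  rwa [show a - x.1 + (b - x.2) = a + b - (k : ℤ) by rw [← hx]; push_cast; ring] at h

theorem C_mem_polyWeightLE {n : ℤ} {f : MvPolynomial ℕ ℂ} (hf : f ∈ weightLE n) :
    C f ∈ polyWeightLE n := by
  intro k
  rw [coeff_C]
  split_ifs with h
  · simpa [h] using hf
  · exact zero_mem _

theorem X_mem_polyWeightLE : (X : (MvPolynomial ℕ ℂ)[X]) ∈ polyWeightLE 1 := by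
  intro k
  rw [coeff_X]
  split_ifs with h
  · simpa [← h] using one_mem_weightLE
  · exact zero_mem _

theorem addPairGen_mem_polyWeightLE (k : ℤ) : addPairGen k ∈ polyWeightLE k := by
  suffices h : ∀ (n : ℕ) (k : ℤ), k < n → addPairGen k ∈ polyWeightLE k from
    h (k.toNat + 1) k (by omega)
  intro n
  induction n with
  | zero =>
    intro k hk
    rw [addPairGen_neg (by simpa using hk)]
    exact zero_mem _
  | succ n ih =>
    intro k hk
    push_cast at hk
    rw [addPairGen_eq]
    have h := mul_mem_polyWeightLE X_mem_polyWeightLE (ih (k - 1) (by omega))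
    rw [add_sub_cancel] at h
    exact sub_mem (add_mem (C_mem_polyWeightLE (eGen_mem_weightLE k)) h)
      (polyWeightLE_mono (by omega) (ih (k - 2) (by omega)))

theorem pow_mem_polyWeightLE {a : ℤ} {P : (MvPolynomial ℕ ℂ)[X]} (hP : P ∈ polyWeightLE a)
    (n : ℕ) : P ^ n ∈ polyWeightLE (n * a) := by
  induction n with
  | zero => simpa using C_mem_polyWeightLE one_mem_weightLE
  | succ n ih =>
    rw [pow_succ]
    convert mul_mem_polyWeightLE ih hP using 2
    push_cast
    ring

theorem prod_mem_polyWeightLE {ι : Type*} (s : Finset ι) {a : ι → ℤ}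
    {P : ι → (MvPolynomial ℕ ℂ)[X]} (hP : ∀ i ∈ s, P i ∈ polyWeightLE (a i)) :
    ∏ i ∈ s, P i ∈ polyWeightLE (∑ i ∈ s, a i) := by
  classical
  induction s using Finset.induction_on with
  | empty => simpa using C_mem_polyWeightLE one_mem_weightLE
  | insert i s hi ih =>
    rw [Finset.prod_insert hi, Finset.sum_insert hi]
    exact mul_mem_polyWeightLE (hP i (Finset.mem_insert_self i s))
      (ih fun j hj => hP j (Finset.mem_insert_of_mem hj))

theorem addPair_mem_polyWeightLE {n : ℤ} {f : MvPolynomial ℕ ℂ} (hf : f ∈ weightLE n) :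
    addPair f ∈ polyWeightLE n := by
  rw [addPair, MvPolynomial.aeval_def, MvPolynomial.eval₂_eq]
  refine Submodule.sum_mem _ fun m hm => ?_
  rw [← Algebra.smul_def]
  refine Submodule.smul_mem _ _ (polyWeightLE_mono (mem_weightLE.1 hf m hm) ?_)
  rw [eWeight, Finsupp.weight_apply, Finsupp.sum]
  refine prod_mem_polyWeightLE _ fun i _ => ?_
  rw [nsmul_eq_mul]
  exact pow_mem_polyWeightLE (addPairGen_mem_polyWeightLE _) _

theorem coeff_addPairGen_of_lt {k : ℤ} {n : ℕ} (h : k < n) : (addPairGen k).coeff n = 0 :=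
  eq_zero_of_mem_weightLE (by omega) (addPairGen_mem_polyWeightLE k n)

theorem coeff_addPairGen_self (k : ℕ) : (addPairGen k).coeff k = 1 := by
  induction k with
  | zero => simp
  | succ k ih =>
    rw [addPairGen_eq, coeff_sub, coeff_add, coeff_C_succ, coeff_X_mul,
      coeff_addPairGen_of_lt (show ((k + 1 : ℕ) : ℤ) - 2 < (k + 1 : ℕ) by omega), Nat.cast_succ,
      add_sub_cancel_right, ih, zero_add, sub_zero]

theorem eq_zero_of_sum_addPairGen_mul_C_eq_zero {N : ℕ} {c : ℕ → MvPolynomial ℕ ℂ}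
    (h : ∑ i ∈ Finset.range N, addPairGen i * C (c i) = 0) {i : ℕ} (hi : i < N) : c i = 0 := by
  induction N with
  | zero => omega
  | succ N ih =>
    have hN : c N = 0 := by
      have h' := congrArg (fun P => coeff P N) h
      simp only [Finset.sum_range_succ, coeff_add, finsetSum_coeff, coeff_mul_C, coeff_zero] at h'
      rwa [coeff_addPairGen_self, one_mul, Finset.sum_eq_zero, zero_add] at h'
      intro i hi
      rw [coeff_addPairGen_of_lt (by exact_mod_cast Finset.mem_range.1 hi), zero_mul]
    rw [Finset.sum_range_succ, hN, map_zero, mul_zero, add_zero] at h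
    rcases Nat.lt_succ_iff_lt_or_eq.1 hi with hi | rfl
    · exact ih h hi
    · exact hN

end Weight

/-! ### Multiplying back by `1 - Xq + q²` -/

section RemovePair

open Polynomial

/-- The algebra homomorphism multiplying the generating series of the elementary symmetric
functions by `1 - Xq + q²`. -/
noncomputable def removePair : MvPolynomial ℕ ℂ →ₐ[ℂ] (MvPolynomial ℕ ℂ)[X] :=
  MvPolynomial.aeval fun j : ℕ =>
    C (eGen ((j : ℤ) + 1)) - X * C (eGen j) + C (eGen ((j : ℤ) - 1))

theorem removePair_X (j : ℕ) : removePair (MvPolynomial.X j) =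
    C (eGen ((j : ℤ) + 1)) - X * C (eGen j) + C (eGen ((j : ℤ) - 1)) :=
  MvPolynomial.aeval_X _ _

theorem removePair_eGen (k : ℤ) :
    removePair (eGen k) = C (eGen k) - X * C (eGen (k - 1)) + C (eGen (k - 2)) := by
  rcases lt_trichotomy k 0 with hk | rfl | hk
  · rw [eGen_neg hk, eGen_neg (show k - 1 < 0 by omega), eGen_neg (show k - 2 < 0 by omega)]
    simp
  · rw [eGen_neg (show (0 : ℤ) - 1 < 0 by omega), eGen_neg (show (0 : ℤ) - 2 < 0 by omega)]
    simp
  · obtain ⟨j, rfl⟩ : ∃ j : ℕ, k = (j : ℤ) + 1 := ⟨(k - 1).toNat, by omega⟩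
    rw [show (j : ℤ) + 1 - 2 = j - 1 by ring, add_sub_cancel_right, ← removePair_X,
      eGen_natCast_succ]

/-- The extension of a homomorphism `Λ → Λ[X]` to `Λ[X]` fixing `X`. -/
noncomputable def extendX (A : MvPolynomial ℕ ℂ →ₐ[ℂ] (MvPolynomial ℕ ℂ)[X]) :
    (MvPolynomial ℕ ℂ)[X] →+* (MvPolynomial ℕ ℂ)[X] :=
  eval₂RingHom (A : MvPolynomial ℕ ℂ →+* (MvPolynomial ℕ ℂ)[X]) X

@[simp] theorem extendX_C (A : MvPolynomial ℕ ℂ →ₐ[ℂ] (MvPolynomial ℕ ℂ)[X])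
    (f : MvPolynomial ℕ ℂ) : extendX A (C f) = A f := by simp [extendX]

@[simp] theorem extendX_X (A : MvPolynomial ℕ ℂ →ₐ[ℂ] (MvPolynomial ℕ ℂ)[X]) :
    extendX A X = X := by simp [extendX]

theorem extendX_comp_eq_C {A B : MvPolynomial ℕ ℂ →ₐ[ℂ] (MvPolynomial ℕ ℂ)[X]}
    (h : ∀ k : ℤ, extendX A (B (eGen k)) = C (eGen k)) (f : MvPolynomial ℕ ℂ) :
    extendX A (B f) = C f := by
  induction f using MvPolynomial.induction_on with
  | C a =>
    rw [← MvPolynomial.algebraMap_eq, AlgHom.commutes, Polynomial.algebraMap_apply, extendX_C,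
      AlgHom.commutes, Polynomial.algebraMap_apply]
  | add p q hp hq => rw [map_add, map_add, map_add, hp, hq]
  | mul_X p i hp => rw [map_mul, map_mul, map_mul, hp, ← eGen_natCast_succ, h]

theorem extendX_addPair_removePair (f : MvPolynomial ℕ ℂ) :
    extendX addPair (removePair f) = C f := by
  refine extendX_comp_eq_C (fun k => ?_) f
  rw [removePair_eGen, map_add, map_sub, map_mul, extendX_C, extendX_C, extendX_C, extendX_X,
    addPair_eGen, addPair_eGen, addPair_eGen, addPairGen_eq k]
  ring

theorem extendX_removePair_addPair (f : MvPolynomial ℕ ℂ) :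
    extendX removePair (addPair f) = C f := by
  refine extendX_comp_eq_C (fun k => ?_) f
  rw [addPair_eGen]
  suffices h : ∀ (n : ℕ) (k : ℤ), k < n → extendX removePair (addPairGen k) = C (eGen k) from
    h (k.toNat + 1) k (by omega)
  intro n
  induction n with
  | zero =>
    intro k hk
    rw [addPairGen_neg (by simpa using hk), eGen_neg (by simpa using hk), map_zero, map_zero]
  | succ n ih =>
    intro k hk
    push_cast at hk
    rw [addPairGen_eq, map_sub, map_add, map_mul, extendX_C, extendX_X, removePair_eGen,
      ih (k - 1) (by omega), ih (k - 2) (by omega)]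
    ring

theorem addPair_injective : Function.Injective addPair := fun f g h => by
  rw [← C_inj, ← extendX_removePair_addPair f, h, extendX_removePair_addPair]

theorem eventually_derivative_removePair (f : MvPolynomial ℕ ℂ) :
    ∀ᶠ N : ℕ in atTop, derivative (removePair f) =
      -∑ i ∈ Finset.range N, C (eGen i) * removePair (MvPolynomial.pderiv i f) := by
  induction f using MvPolynomial.induction_on with
  | C a =>
    refine Eventually.of_forall fun N => ?_
    rw [← MvPolynomial.algebraMap_eq, AlgHom.commutes, Polynomial.algebraMap_apply]
    simp [MvPolynomial.algebraMap_eq]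
  | add p q hp hq =>
    filter_upwards [hp, hq] with N hp hq
    simp only [map_add, mul_add, Finset.sum_add_distrib, hp, hq]
    ring
  | mul_X p j hp =>
    filter_upwards [hp, eventually_gt_atTop j] with N hp hj
    have hX : derivative (removePair (MvPolynomial.X j)) = -C (eGen j) := by
      rw [removePair_X]
      simp
    have hs : ∀ i : ℕ, C (eGen i) * removePair (MvPolynomial.pderiv i (p * MvPolynomial.X j)) =
        C (eGen i) * removePair (MvPolynomial.pderiv i p) * removePair (MvPolynomial.X j) +
          if j = i then C (eGen i) * removePair p else 0 := by
      intro i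
      rw [Derivation.leibniz, MvPolynomial.pderiv_X, smul_eq_mul, smul_eq_mul, map_add, map_mul,
        map_mul]
      by_cases h : j = i
      · subst h
        simp only [Pi.single_eq_same, map_one, if_true]
        ring
      · rw [Pi.single_eq_of_ne h, map_zero, if_neg h]
        ring
    rw [Finset.sum_congr rfl fun i _ => hs i, Finset.sum_add_distrib, ← Finset.sum_mul,
      Finset.sum_ite_eq, if_pos (Finset.mem_range.2 hj), map_mul, derivative_mul, hX, hp]
    ring

theorem eq_C_of_pderiv_eq_zero {f : MvPolynomial ℕ ℂ} (h : ∀ i, MvPolynomial.pderiv i f = 0) :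
    f = MvPolynomial.C (f.coeff 0) := by
  ext m
  rw [MvPolynomial.coeff_C]
  split_ifs with hm
  · rw [hm]
  obtain ⟨i, hi⟩ := Finsupp.ne_iff.1 (Ne.symm hm)
  have h' := congrArg (MvPolynomial.coeff (m - Finsupp.single i 1)) (h i)
  have hle : Finsupp.single i 1 ≤ m :=
    Finsupp.single_le_iff.2 (Nat.one_le_iff_ne_zero.2 hi)
  rw [MvPolynomial.coeff_pderiv, tsub_add_cancel_of_le hle, MvPolynomial.coeff_zero] at h'
  exact (mul_eq_zero.1 h').resolve_right (Nat.cast_add_one_ne_zero _)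

theorem eq_C_of_addPair_eq_C {f g : MvPolynomial ℕ ℂ} (h : addPair f = C g) :
    g = MvPolynomial.C (g.coeff 0) := by
  have hg : removePair g = C f := by
    rw [← extendX_removePair_addPair, h, extendX_C]
  refine eq_C_of_pderiv_eq_zero fun i => ?_
  obtain ⟨N, hN, hi⟩ := ((eventually_derivative_removePair g).and (eventually_gt_atTop i)).exists
  rw [hg, derivative_C, eq_comm, neg_eq_zero] at hN
  have h' := congrArg (extendX addPair) hN
  simp only [map_sum, map_mul, extendX_C, map_zero, addPair_eGen,
    extendX_addPair_removePair] at h'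
  exact eq_zero_of_sum_addPairGen_mul_C_eq_zero h' hi

theorem IsLaguerreFunctional.eq_zero_of_forall_mul_eq_zero {n : ℕ} {z z' : ℂ} (hz : NonInteger z)
    (hz' : NonInteger z') {ψ : MvPolynomial ℕ ℂ →ₗ[ℂ] ℂ} (hψ : IsLaguerreFunctional z z' ψ)
    {f : MvPolynomial ℕ ℂ} (hn : f ∈ weightLE n) (hf : ∀ g, ψ (f * g) = 0) : f = 0 := by
  induction n using Nat.strong_induction_on generalizing z z' ψ f with
  | _ n ih =>
    obtain ⟨φ, hφ, hlim⟩ := hψ.exists_limit hz hz'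
    have hker := coeff_addPair_mem_ker hz hz' hlim hf
    have htwo : ∀ {w : ℂ}, NonInteger w → NonInteger (w + 2) := fun {w} hw => by
      have := hw.add_one.add_one
      rwa [add_assoc, one_add_one_eq_two] at this
    have hC : addPair f = C ((addPair f).coeff 0) := by
      ext1 k
      rcases Nat.eq_zero_or_pos k with rfl | hk
      · rw [coeff_C_zero]
      rw [coeff_C, if_neg hk.ne']
      have hmem := addPair_mem_polyWeightLE hn k
      rcases lt_or_ge n k with hnk | hnk
      · exact eq_zero_of_mem_weightLE (by omega) hmem
      · rw [← Nat.cast_sub hnk] at hmem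
        exact ih (n - k) (by omega) (htwo hz) (htwo hz') hφ hmem (hker k)
    have hconst := eq_C_of_addPair_eq_C hC
    have h0 := hker 0 1
    rw [mul_one, hconst, ← mul_one (MvPolynomial.C _), ← MvPolynomial.smul_eq_C_mul, map_smul,
      hφ.map_one, smul_eq_mul, mul_one] at h0
    rw [h0, map_zero] at hconst
    rw [hconst, map_zero] at hC
    exact addPair_injective (hC.trans (map_zero _).symm)

end RemovePair

/-- If `z` and `z'` are non-integers, then the bilinear form `(f,g) := ψ(fg)`
on `Λ` is nondegenerate. -/
theorem laguerre_form_nondegenerate (z z' : ℂ)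
    (hz : ∀ n : ℤ, z ≠ (n : ℂ)) (hz' : ∀ n : ℤ, z' ≠ (n : ℂ))
    (ψ : MvPolynomial ℕ ℂ →ₗ[ℂ] ℂ)
    (hψ : ∀ ν : YoungDiagram, ψ (SchurF ν) =
      contentProd z z' ν.cells * ((dimSkew ⊥ ν : ℂ) / (Nat.factorial ν.card : ℂ)) ^ 2)
    (f : MvPolynomial ℕ ℂ) (hf : f ≠ 0) :
    ∃ g : MvPolynomial ℕ ℂ, ψ (f * g) ≠ 0 := by
  by_contra! h
  obtain ⟨n, hn⟩ := exists_mem_weightLE f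
  exact hf ((isLaguerreFunctional_of_SchurF hψ).eq_zero_of_forall_mul_eq_zero hz hz' hn h)
end

section
/- The mixed z-measure M_{z,z',ξ}(λ) = (1-ξ)^{zz'} ∏_{□∈λ}(z+c(□))(z'+c(□)) · ξ^{|λ|} (dim λ/|λ|!)² sums to 1 over all Young diagrams λ, for z' = z̄ nonreal and 0 < ξ < 1. -/
open scoped BigOperators

namespace YoungDiagram

theorem rowLen_le_card (μ : YoungDiagram) (i : ℕ) : μ.rowLen i ≤ μ.card := by
  rw [rowLen_eq_card]
  exact Finset.card_le_card (Finset.filter_subset _ _)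

theorem colLen_le_card (μ : YoungDiagram) (j : ℕ) : μ.colLen j ≤ μ.card := by
  rw [colLen_eq_card]
  exact Finset.card_le_card (Finset.filter_subset _ _)

theorem fst_lt_card {μ : YoungDiagram} {b : ℕ × ℕ} (hb : b ∈ μ) : b.1 < μ.card :=
  (mem_iff_lt_colLen.1 hb).trans_le (μ.colLen_le_card b.2)

theorem snd_lt_card {μ : YoungDiagram} {b : ℕ × ℕ} (hb : b ∈ μ) : b.2 < μ.card :=
  (mem_iff_lt_rowLen.1 hb).trans_le (μ.rowLen_le_card b.1)

theorem rowLen_card (μ : YoungDiagram) : μ.rowLen μ.card = 0 := by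
  by_contra h
  exact lt_irrefl _ (fst_lt_card (mem_iff_lt_rowLen.2 (Nat.pos_of_ne_zero h)))

theorem sum_rowLen (μ : YoungDiagram) : ∑ i ∈ Finset.range μ.card, μ.rowLen i = μ.card := by
  simp only [rowLen_eq_card]
  exact (Finset.card_eq_sum_card_fiberwise fun b hb ↦
    Finset.mem_coe.2 (Finset.mem_range.2 (fst_lt_card hb))).symm

theorem finite_setOf_card_eq (n : ℕ) : {μ : YoungDiagram | μ.card = n}.Finite := by
  refine Set.Finite.of_finite_image (f := cells)
    ((Finset.range n ×ˢ Finset.range n).powerset.finite_toSet.subset ?_)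
    (fun μ _ ν _ h ↦ YoungDiagram.ext h)
  rintro _ ⟨μ, rfl, rfl⟩
  simp only [Finset.coe_powerset, Set.mem_preimage, Set.mem_powerset_iff]
  intro b hb
  simpa using ⟨fst_lt_card hb, snd_lt_card hb⟩

/-- The Young diagrams with `n` boxes. -/
noncomputable def level (n : ℕ) : Finset YoungDiagram := (finite_setOf_card_eq n).toFinset

@[simp]
theorem mem_level {n : ℕ} {μ : YoungDiagram} : μ ∈ level n ↔ μ.card = n := by
  simp [level]

theorem card_eq_zero {μ : YoungDiagram} : μ.card = 0 ↔ μ = ⊥ := by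
  simp [YoungDiagram.ext_iff]

theorem level_zero : level 0 = {⊥} := by
  ext μ
  rw [mem_level, card_eq_zero, Finset.mem_singleton]

open Classical in
/-- The Young diagrams obtained from `μ` by adding one box. -/
noncomputable def upper (μ : YoungDiagram) : Finset YoungDiagram :=
  (level (μ.card + 1)).filter (μ ≤ ·)

open Classical in
/-- The Young diagrams obtained from `μ` by removing one box. -/
noncomputable def lower (μ : YoungDiagram) : Finset YoungDiagram :=
  (level (μ.card - 1)).filter fun ν ↦ ν ≤ μ ∧ μ.card = ν.card + 1

@[simp]
theorem mem_upper {μ ν : YoungDiagram} : ν ∈ upper μ ↔ μ ≤ ν ∧ ν.card = μ.card + 1 := by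
  simp [upper, and_comm]

@[simp]
theorem mem_lower {μ ν : YoungDiagram} : ν ∈ lower μ ↔ ν ≤ μ ∧ μ.card = ν.card + 1 := by
  simp only [lower, Finset.mem_filter, mem_level, and_iff_right_iff_imp]
  omega

theorem card_mono {μ ν : YoungDiagram} (h : μ ≤ ν) : μ.card ≤ ν.card :=
  Finset.card_le_card h

theorem eq_of_le_of_card_le {μ ν : YoungDiagram} (h : μ ≤ ν) (hc : ν.card ≤ μ.card) : μ = ν :=
  YoungDiagram.ext (Finset.eq_of_subset_of_card_le h hc)

theorem card_sup_add_card_inf (μ ν : YoungDiagram) :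
    (μ ⊔ ν).card + (μ ⊓ ν).card = μ.card + ν.card := by
  simp only [YoungDiagram.card, cells_sup, cells_inf, Finset.card_union_add_card_inter]

theorem exists_sdiff_eq_singleton {μ ν : YoungDiagram} (h : μ ≤ ν) (hc : ν.card = μ.card + 1) :
    ∃ b, ν.cells \ μ.cells = {b} := by
  rw [← Finset.card_eq_one, Finset.card_sdiff_of_subset h]
  simp only [YoungDiagram.card] at hc
  omega

/-- A box of row `i` can be added to `μ`. -/
def Addable (μ : YoungDiagram) (i : ℕ) : Prop := ∀ k < i, μ.rowLen i < μ.rowLen k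

/-- The diagram `μ` with a box added at the end of row `i`. -/
def addBox (μ : YoungDiagram) (i : ℕ) (hi : μ.Addable i) : YoungDiagram where
  cells := insert (i, μ.rowLen i) μ.cells
  isLowerSet := by
    rintro ⟨a, b⟩ ⟨c, d⟩ hle h
    obtain ⟨hca, hdb⟩ : c ≤ a ∧ d ≤ b := hle
    simp only [Finset.coe_insert, Set.mem_insert_iff, Prod.mk.injEq, Finset.mem_coe,
      mem_cells] at h ⊢
    rcases h with ⟨rfl, rfl⟩ | h
    · rcases hca.lt_or_eq with hc | rfl
      · exact .inr (mem_iff_lt_rowLen.2 (hdb.trans_lt (hi c hc)))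
      · rcases hdb.lt_or_eq with hd | rfl
        · exact .inr (mem_iff_lt_rowLen.2 hd)
        · exact .inl ⟨rfl, rfl⟩
    · exact .inr (μ.up_left_mem hca hdb h)

/-- The diagram `μ` with the last box of row `i` removed. -/
def removeBox (μ : YoungDiagram) (i : ℕ) (hi : μ.rowLen (i + 1) < μ.rowLen i) : YoungDiagram where
  cells := μ.cells.erase (i, μ.rowLen i - 1)
  isLowerSet := by
    rintro ⟨a, b⟩ ⟨c, d⟩ hle h
    obtain ⟨hca, hdb⟩ : c ≤ a ∧ d ≤ b := hle
    simp only [Finset.coe_erase, Set.mem_sdiff, Set.mem_singleton_iff, Prod.mk.injEq,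
      Finset.mem_coe, mem_cells] at h ⊢
    refine ⟨μ.up_left_mem hca hdb h.1, ?_⟩
    rintro ⟨rfl, rfl⟩
    have hb := mem_iff_lt_rowLen.1 h.1
    rcases hca.lt_or_eq with hc | rfl
    · have := μ.rowLen_anti (c + 1) a hc
      omega
    · exact h.2 ⟨rfl, by omega⟩

theorem notMem_rowLen (μ : YoungDiagram) (i : ℕ) : (i, μ.rowLen i) ∉ μ.cells := by
  simp [mem_iff_lt_rowLen]

theorem addBox_sdiff (μ : YoungDiagram) (i : ℕ) (hi : μ.Addable i) :
    (μ.addBox i hi).cells \ μ.cells = {(i, μ.rowLen i)} := by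
  simp [addBox, Finset.insert_sdiff_of_notMem _ (μ.notMem_rowLen i)]

theorem sdiff_removeBox (μ : YoungDiagram) (i : ℕ) (hi : μ.rowLen (i + 1) < μ.rowLen i) :
    μ.cells \ (μ.removeBox i hi).cells = {(i, μ.rowLen i - 1)} := by
  have : (i, μ.rowLen i - 1) ∈ μ.cells := by
    rw [mem_cells, mem_iff_lt_rowLen]; omega
  simp [removeBox, Finset.sdiff_erase this]

theorem addBox_mem_upper (μ : YoungDiagram) (i : ℕ) (hi : μ.Addable i) :
    μ.addBox i hi ∈ upper μ :=
  mem_upper.2 ⟨Finset.subset_insert _ _, Finset.card_insert_of_notMem (μ.notMem_rowLen i)⟩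

theorem removeBox_mem_lower (μ : YoungDiagram) (i : ℕ) (hi : μ.rowLen (i + 1) < μ.rowLen i) :
    μ.removeBox i hi ∈ lower μ := by
  refine mem_lower.2 ⟨Finset.erase_subset _ _, ?_⟩
  refine (Finset.card_erase_add_one ?_).symm
  rw [mem_cells, mem_iff_lt_rowLen]
  omega

theorem eq_of_sdiff_eq {μ ν ν' : YoungDiagram} (h : μ ≤ ν) (h' : μ ≤ ν')
    (hd : ν.cells \ μ.cells = ν'.cells \ μ.cells) : ν = ν' :=
  YoungDiagram.ext (by
    rw [← Finset.sdiff_union_of_subset h, ← Finset.sdiff_union_of_subset h', hd])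

theorem eq_of_sdiff_eq' {μ μ' ν : YoungDiagram} (h : μ ≤ ν) (h' : μ' ≤ ν)
    (hd : ν.cells \ μ.cells = ν.cells \ μ'.cells) : μ = μ' :=
  YoungDiagram.ext (by
    rw [← Finset.sdiff_sdiff_eq_self h, ← Finset.sdiff_sdiff_eq_self h', hd])

theorem exists_eq_addBox {μ ν : YoungDiagram} (h : ν ∈ upper μ) :
    ∃ i, ∃ hi : μ.Addable i, i ≤ μ.card ∧ μ.addBox i hi = ν := by
  rw [mem_upper] at h
  obtain ⟨⟨i, j⟩, hb⟩ := exists_sdiff_eq_singleton h.1 h.2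
  have key : ∀ c, c ∈ ν → c ≠ (i, j) → c ∈ μ := by
    intro c hc hne
    by_contra hcμ
    exact hne (Finset.mem_singleton.1 (hb ▸ Finset.mem_sdiff.2 ⟨hc, hcμ⟩))
  obtain ⟨hν, hμ⟩ := Finset.mem_sdiff.1 (hb.symm ▸ Finset.mem_singleton_self (i, j))
  rw [mem_cells] at hν hμ
  have hj : μ.rowLen i = j := by
    refine le_antisymm (not_lt.1 fun hlt ↦ hμ (mem_iff_lt_rowLen.2 hlt)) (not_lt.1 fun hlt ↦ ?_)
    have := mem_iff_lt_rowLen.1 (key (i, μ.rowLen i) (ν.up_left_mem le_rfl hlt.le hν)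
      (by simp [hlt.ne]))
    exact lt_irrefl _ this
  have hi : μ.Addable i := by
    intro k hk
    rw [hj, ← mem_iff_lt_rowLen]
    exact key (k, j) (ν.up_left_mem hk.le le_rfl hν) (by simp [hk.ne])
  refine ⟨i, hi, ?_, eq_of_sdiff_eq (mem_upper.1 (μ.addBox_mem_upper i hi)).1 h.1 ?_⟩
  · have := fst_lt_card hν
    simp only at this
    omega
  · rw [addBox_sdiff, hb, hj]

theorem exists_eq_removeBox {μ ν : YoungDiagram} (h : ν ∈ lower μ) :
    ∃ i, ∃ hi : μ.rowLen (i + 1) < μ.rowLen i, i < μ.card ∧ μ.removeBox i hi = ν := by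
  rw [mem_lower] at h
  obtain ⟨⟨i, j⟩, hb⟩ := exists_sdiff_eq_singleton h.1 h.2
  obtain ⟨hμ, hν⟩ := Finset.mem_sdiff.1 (hb.symm ▸ Finset.mem_singleton_self (i, j))
  rw [mem_cells] at hν hμ
  have key : ∀ c, (i, j) ≤ c → c ≠ (i, j) → c ∉ μ := by
    intro c hle hne hcμ
    refine hne (Finset.mem_singleton.1 (hb ▸ Finset.mem_sdiff.2 ⟨hcμ, fun hcν ↦ hν ?_⟩))
    exact ν.up_left_mem hle.1 hle.2 hcν
  have hj := mem_iff_lt_rowLen.1 hμ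
  have hj' : μ.rowLen i ≤ j + 1 := by
    have := key (i, j + 1) ⟨le_rfl, Nat.le_succ j⟩ (by simp)
    rwa [mem_iff_lt_rowLen, not_lt] at this
  have hi : μ.rowLen (i + 1) ≤ j := by
    have := key (i + 1, j) ⟨Nat.le_succ i, le_rfl⟩ (by simp)
    rwa [mem_iff_lt_rowLen, not_lt] at this
  have hi' : μ.rowLen (i + 1) < μ.rowLen i := by omega
  refine ⟨i, hi', fst_lt_card hμ,
    eq_of_sdiff_eq' (mem_lower.1 (μ.removeBox_mem_lower i hi')).1 h.1 ?_⟩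
  rw [sdiff_removeBox, hb, show μ.rowLen i - 1 = j by omega]

theorem addable_zero (μ : YoungDiagram) : μ.Addable 0 := fun _ hk ↦ absurd hk (Nat.not_lt_zero _)

theorem addable_succ {μ : YoungDiagram} {i : ℕ} :
    μ.Addable (i + 1) ↔ μ.rowLen (i + 1) < μ.rowLen i :=
  ⟨fun h ↦ h i (Nat.lt_succ_self i), fun h _ hk ↦
    h.trans_le (μ.rowLen_anti _ _ (Nat.lt_succ_iff.1 hk))⟩

open Classical in
theorem sum_upper {M : Type*} [AddCommMonoid M] (μ : YoungDiagram) (f : Finset (ℕ × ℕ) → M) :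
    ∑ ν ∈ upper μ, f (ν.cells \ μ.cells) =
      ∑ i ∈ Finset.range (μ.card + 1), if μ.Addable i then f {(i, μ.rowLen i)} else 0 := by
  rw [← Finset.sum_filter]
  symm
  refine Finset.sum_bij (fun i hi ↦ μ.addBox i (Finset.mem_filter.1 hi).2)
    (fun i hi ↦ addBox_mem_upper _ _ _) ?_ ?_ ?_
  · intro i hi k hk h
    have := congrArg (fun ν : YoungDiagram ↦ ν.cells \ μ.cells) h
    simp only [addBox_sdiff, Finset.singleton_inj, Prod.mk.injEq] at this
    exact this.1
  · intro ν hν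
    obtain ⟨i, hi, hle, rfl⟩ := exists_eq_addBox hν
    exact ⟨i, by simp [hi]; omega, rfl⟩
  · intro i hi
    rw [addBox_sdiff]

theorem sum_lower {M : Type*} [AddCommMonoid M] (μ : YoungDiagram) (f : Finset (ℕ × ℕ) → M) :
    ∑ ν ∈ lower μ, f (μ.cells \ ν.cells) =
      ∑ i ∈ Finset.range μ.card,
        if μ.rowLen (i + 1) < μ.rowLen i then f {(i, μ.rowLen i - 1)} else 0 := by
  rw [← Finset.sum_filter]
  symm
  refine Finset.sum_bij (fun i hi ↦ μ.removeBox i (Finset.mem_filter.1 hi).2)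
    (fun i hi ↦ removeBox_mem_lower _ _ _) ?_ ?_ ?_
  · intro i hi k hk h
    have := congrArg (fun ν : YoungDiagram ↦ μ.cells \ ν.cells) h
    simp only [sdiff_removeBox, Finset.singleton_inj, Prod.mk.injEq] at this
    exact this.1
  · intro ν hν
    obtain ⟨i, hi, hle, rfl⟩ := exists_eq_removeBox hν
    exact ⟨i, by simp [hi, hle], rfl⟩
  · intro i hi
    rw [sdiff_removeBox]

section ContentProd

variable {R : Type*} [CommRing R] (z z' : R)

theorem sum_upper_contentProd_sub_sum_lower (μ : YoungDiagram) :
    ∑ ν ∈ upper μ, contentProd z z' (ν.cells \ μ.cells) -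
      ∑ ν ∈ lower μ, contentProd z z' (μ.cells \ ν.cells) = z * z' + 2 * μ.card := by
  classical
  have key : ∀ N : ℕ,
      (∑ i ∈ Finset.range (N + 1),
        if μ.Addable i then contentProd z z' {(i, μ.rowLen i)} else 0) -
      (∑ i ∈ Finset.range N,
        if μ.rowLen (i + 1) < μ.rowLen i then contentProd z z' {(i, μ.rowLen i - 1)} else 0) =
      z * z' + (z + z') * μ.rowLen N + (μ.rowLen N : R) ^ 2 - 2 * N * μ.rowLen N +
        2 * ((∑ i ∈ Finset.range N, μ.rowLen i : ℕ) : R) := by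
    intro N
    induction N with
    | zero =>
      simp [addable_zero, contentProd]
      ring
    | succ N ih =>
      rw [Finset.sum_range_succ _ (N + 1), Finset.sum_range_succ (fun i ↦ ite (_ < _) _ _) N,
        add_sub_add_comm, ih]
      simp only [addable_succ]
      split_ifs with h
      · have h1 : 1 ≤ μ.rowLen N := by omega
        simp only [contentProd, Finset.prod_singleton, Finset.sum_range_succ]
        push_cast [h1]
        ring
      · have h1 : μ.rowLen (N + 1) = μ.rowLen N :=
          le_antisymm (μ.rowLen_anti _ _ (Nat.le_succ N)) (not_lt.1 h)
        rw [h1, Finset.sum_range_succ]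
        push_cast
        ring
  rw [sum_upper, sum_lower, key, sum_rowLen, rowLen_card]
  simp

end ContentProd

/-- The chains `c 0 = ⊥, c 1, …, c n = μ` adding one box at each of the `n` steps, and constant
from `n` on. -/
abbrev BoxChain (n : ℕ) (μ : YoungDiagram) : Type :=
  {c : ℕ → YoungDiagram // c 0 = ⊥ ∧
    (∀ i, i < n → c i ≤ c (i + 1) ∧ (c (i + 1)).card = (c i).card + 1) ∧ ∀ i, n ≤ i → c i = μ}

theorem dimSkew_bot (μ : YoungDiagram) : dimSkew ⊥ μ = Nat.card (BoxChain μ.card μ) := by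
  have : (⊥ : YoungDiagram).card = 0 := card_eq_zero.2 rfl
  simp only [dimSkew, this, Nat.sub_zero]

/-- The last diagram before `μ` in a chain of length `n + 1` ending at `μ`. -/
def BoxChain.penultimate {n : ℕ} {μ : YoungDiagram} (c : BoxChain (n + 1) μ) : lower μ :=
  ⟨c.1 n, mem_lower.2 (by
    simpa only [c.2.2.2 (n + 1) le_rfl] using c.2.2.1 n (Nat.lt_succ_self n))⟩

/-- Chains with prescribed penultimate diagram `ν` are chains ending at `ν`. -/
def BoxChain.fiberEquiv {n : ℕ} {μ : YoungDiagram} (ν : lower μ) :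
    {c : BoxChain (n + 1) μ // c.penultimate = ν} ≃ BoxChain n ν where
  toFun c := ⟨fun i ↦ c.1.1 (min i n), by simpa using c.1.2.1, fun i hi ↦ by
      beta_reduce
      rw [min_eq_left hi.le, min_eq_left hi]
      exact c.1.2.2.1 i (by omega), fun i hi ↦ by
      beta_reduce
      rw [min_eq_right hi]
      exact congrArg Subtype.val c.2⟩
  invFun c := ⟨⟨fun i ↦ if i ≤ n then c.1 i else μ, by simpa using c.2.1, fun i hi ↦ by
      beta_reduce
      rcases (Nat.lt_succ_iff.1 hi).lt_or_eq with h | rfl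
      · rw [if_pos h.le, if_pos (Nat.succ_le_of_lt h)]
        exact c.2.2.1 i h
      · rw [if_pos le_rfl, if_neg (by omega), c.2.2.2 i le_rfl]
        exact mem_lower.1 ν.2, fun i hi ↦ if_neg (by omega)⟩, by
      refine Subtype.ext ?_
      simp [penultimate, c.2.2.2 n le_rfl]⟩
  left_inv c := by
    refine Subtype.ext (Subtype.ext (funext fun i ↦ ?_))
    by_cases h : i ≤ n
    · simp [h]
    · simp only [h, if_false]
      exact (c.1.2.2.2 i (by omega)).symm
  right_inv c := by
    refine Subtype.ext (funext fun i ↦ ?_)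
    rcases le_total i n with h | h
    · simp [h]
    · simp [h, c.2.2.2 i h, c.2.2.2 n le_rfl]

/-- Chains ending at `μ` sorted by their penultimate diagram. -/
def BoxChain.sigmaEquiv (n : ℕ) (μ : YoungDiagram) :
    BoxChain (n + 1) μ ≃ Σ ν : lower μ, BoxChain n ν :=
  (Equiv.sigmaFiberEquiv BoxChain.penultimate).symm.trans
    (Equiv.sigmaCongrRight BoxChain.fiberEquiv)

instance BoxChain.finite (n : ℕ) (μ : YoungDiagram) : Finite (BoxChain n μ) := by
  induction n generalizing μ with
  | zero =>
    have : Subsingleton (BoxChain 0 μ) := ⟨fun c c' ↦ Subtype.ext (funext fun i ↦ by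
      rw [c.2.2.2 i (Nat.zero_le i), c'.2.2.2 i (Nat.zero_le i)])⟩
    infer_instance
  | succ n ih => exact Finite.of_equiv _ (BoxChain.sigmaEquiv n μ).symm

theorem dimSkew_bot_bot : dimSkew ⊥ ⊥ = 1 := by
  rw [dimSkew_bot, card_eq_zero.2 rfl, Nat.card_eq_one_iff_unique]
  refine ⟨⟨fun c c' ↦ Subtype.ext (funext fun i ↦ ?_)⟩,
    ⟨⟨fun _ ↦ ⊥, rfl, fun i hi ↦ absurd hi (Nat.not_lt_zero i), fun _ _ ↦ rfl⟩⟩⟩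
  rw [c.2.2.2 i (Nat.zero_le i), c'.2.2.2 i (Nat.zero_le i)]

theorem dimSkew_bot_eq_sum_lower {μ : YoungDiagram} (hμ : μ.card ≠ 0) :
    dimSkew ⊥ μ = ∑ ν ∈ lower μ, dimSkew ⊥ ν := by
  obtain ⟨n, hn⟩ := Nat.exists_eq_succ_of_ne_zero hμ
  rw [dimSkew_bot, hn, Nat.card_congr (BoxChain.sigmaEquiv n μ), Nat.card_sigma,
    ← Finset.sum_coe_sort (lower μ) fun ν ↦ dimSkew ⊥ ν]
  refine Finset.sum_congr rfl fun ν _ ↦ ?_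
  rw [dimSkew_bot, show (ν : YoungDiagram).card = n from by have := (mem_lower.1 ν.2).2; omega]

theorem inf_mem_lower {μ ν ρ : YoungDiagram} (hρμ : ρ ∈ upper μ) (hν : ν ∈ lower ρ)
    (hne : ν ≠ μ) : μ ⊓ ν ∈ lower μ ∧ ν ∈ upper (μ ⊓ ν) ∧ μ ⊔ ν = ρ := by
  rw [mem_upper] at hρμ
  rw [mem_lower] at hν
  have hsup : μ ⊔ ν ≤ ρ := sup_le hρμ.1 hν.1
  have hlt : μ.card < (μ ⊔ ν).card := by
    by_contra! hle
    have h1 : μ = μ ⊔ ν := eq_of_le_of_card_le le_sup_left hle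
    exact hne (eq_of_le_of_card_le (by rw [h1]; exact le_sup_right) (by omega))
  have := card_mono hsup
  have hadd := card_sup_add_card_inf μ ν
  refine ⟨mem_lower.2 ⟨inf_le_left, by omega⟩, mem_upper.2 ⟨inf_le_right, by omega⟩,
    eq_of_le_of_card_le hsup (by omega)⟩

theorem sup_mem_upper {μ ν ρ : YoungDiagram} (hρμ : ρ ∈ lower μ) (hν : ν ∈ upper ρ)
    (hne : ν ≠ μ) : μ ⊔ ν ∈ upper μ ∧ ν ∈ lower (μ ⊔ ν) ∧ μ ⊓ ν = ρ := by
  rw [mem_lower] at hρμ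
  rw [mem_upper] at hν
  have hinf : ρ ≤ μ ⊓ ν := le_inf hρμ.1 hν.1
  have hlt : (μ ⊓ ν).card < μ.card := by
    by_contra! hle
    have h1 : μ ⊓ ν = μ := eq_of_le_of_card_le inf_le_left hle
    exact hne (eq_of_le_of_card_le (inf_eq_left.1 h1) (by omega)).symm
  have := card_mono hinf
  have hadd := card_sup_add_card_inf μ ν
  refine ⟨mem_upper.2 ⟨le_sup_left, by omega⟩, mem_lower.2 ⟨le_sup_right, by omega⟩,
    (eq_of_le_of_card_le hinf (by omega)).symm⟩

open Classical in
theorem sum_upper_sum_lower_erase {M : Type*} [AddCommMonoid M] (μ : YoungDiagram)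
    (f : Finset (ℕ × ℕ) → YoungDiagram → M) :
    ∑ ρ ∈ upper μ, ∑ ν ∈ (lower ρ).erase μ, f (ρ.cells \ μ.cells) ν =
      ∑ ρ ∈ lower μ, ∑ ν ∈ (upper ρ).erase μ, f (ν.cells \ ρ.cells) ν := by
  rw [Finset.sum_sigma', Finset.sum_sigma']
  refine Finset.sum_bij' (fun x _ ↦ ⟨μ ⊓ x.2, x.2⟩) (fun x _ ↦ ⟨μ ⊔ x.2, x.2⟩) ?_ ?_ ?_ ?_ ?_ <;>
    rintro ⟨ρ, ν⟩ h <;> obtain ⟨hρ, hν⟩ := Finset.mem_sigma.1 h <;>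
    obtain ⟨hne, hν⟩ := Finset.mem_erase.1 hν
  · obtain ⟨h1, h2, -⟩ := inf_mem_lower hρ hν hne
    exact Finset.mem_sigma.2 ⟨h1, Finset.mem_erase.2 ⟨hne, h2⟩⟩
  · obtain ⟨h1, h2, -⟩ := sup_mem_upper hρ hν hne
    exact Finset.mem_sigma.2 ⟨h1, Finset.mem_erase.2 ⟨hne, h2⟩⟩
  · simp only [(inf_mem_lower hρ hν hne).2.2]
  · simp only [(sup_mem_upper hρ hν hne).2.2]
  · dsimp only at hρ hν hne ⊢
    obtain ⟨-, -, rfl⟩ := inf_mem_lower hρ hν hne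
    congr 1
    ext b
    simp only [cells_sup, cells_inf, Finset.mem_sdiff, Finset.mem_union, Finset.mem_inter]
    tauto

section ContentProd

variable {R : Type*} [CommRing R] (z z' : R)

theorem sum_upper_contentProd_mul_dimSkew (μ : YoungDiagram) :
    ∑ ν ∈ upper μ, contentProd z z' (ν.cells \ μ.cells) * (dimSkew ⊥ ν : R) =
      (z * z' + μ.card) * (μ.card + 1) * (dimSkew ⊥ μ : R) := by
  classical
  have expand (μ : YoungDiagram) :
      ∑ ν ∈ upper μ, contentProd z z' (ν.cells \ μ.cells) * (dimSkew ⊥ ν : R) =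
      (∑ ν ∈ upper μ, contentProd z z' (ν.cells \ μ.cells)) * (dimSkew ⊥ μ : R) +
      ∑ ρ ∈ lower μ, ∑ ν ∈ (upper ρ).erase μ,
        contentProd z z' (ν.cells \ ρ.cells) * (dimSkew ⊥ ν : R) := by
    rw [← sum_upper_sum_lower_erase μ fun s ν ↦ contentProd z z' s * (dimSkew ⊥ ν : R),
      Finset.sum_mul, ← Finset.sum_add_distrib]
    refine Finset.sum_congr rfl fun ν hν ↦ ?_
    have hν' := mem_upper.1 hν
    rw [dimSkew_bot_eq_sum_lower (by omega : ν.card ≠ 0), Nat.cast_sum, Finset.mul_sum,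
      Finset.add_sum_erase (lower ν)
        (fun ρ ↦ contentProd z z' (ν.cells \ μ.cells) * (dimSkew ⊥ ρ : R)) (mem_lower.2 hν')]
  obtain ⟨n, hn⟩ : ∃ n, μ.card = n := ⟨_, rfl⟩
  induction n generalizing μ with
  | zero =>
    have diag := sum_upper_contentProd_sub_sum_lower z z' μ
    have hlow : lower μ = ∅ := by
      ext ρ
      simp only [mem_lower, Finset.notMem_empty, iff_false]
      omega
    rw [hlow, Finset.sum_empty, sub_zero] at diag
    rw [expand, hlow, Finset.sum_empty, diag, hn]
    push_cast
    ring
  | succ n ih =>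
    have hlow : ∑ ρ ∈ lower μ, ∑ ν ∈ (upper ρ).erase μ,
        contentProd z z' (ν.cells \ ρ.cells) * (dimSkew ⊥ ν : R) =
        (z * z' + n) * (n + 1) * (dimSkew ⊥ μ : R) -
          (∑ ρ ∈ lower μ, contentProd z z' (μ.cells \ ρ.cells)) * (dimSkew ⊥ μ : R) := by
      calc _ = ∑ ρ ∈ lower μ, ((z * z' + n) * (n + 1) * (dimSkew ⊥ ρ : R) -
            contentProd z z' (μ.cells \ ρ.cells) * (dimSkew ⊥ μ : R)) := by
            refine Finset.sum_congr rfl fun ρ hρ ↦ ?_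
            have hρ' := mem_lower.1 hρ
            have hcard : ρ.card = n := by omega
            rw [Finset.sum_erase_eq_sub (mem_upper.2 hρ'), ih ρ hcard, hcard]
        _ = _ := by
            rw [Finset.sum_sub_distrib, ← Finset.mul_sum, ← Finset.sum_mul, ← Nat.cast_sum,
              ← dimSkew_bot_eq_sum_lower (by omega)]
    rw [expand, hlow, sub_eq_iff_eq_add.1 (sum_upper_contentProd_sub_sum_lower z z' μ), hn]
    push_cast
    ring

/-- The sum of the weights of the Young diagrams with `n` boxes. -/
theorem sum_level_contentProd_mul_dimSkew_sq (n : ℕ) :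
    ∑ μ ∈ level n, contentProd z z' μ.cells * (dimSkew ⊥ μ : R) ^ 2 =
      n.factorial * ∏ i ∈ Finset.range n, (z * z' + i) := by
  induction n with
  | zero => simp [level_zero, dimSkew_bot_bot, contentProd]
  | succ n ih =>
    have hs : ∀ (ν : YoungDiagram), ν ∈ level (n + 1) →
        contentProd z z' ν.cells * (dimSkew ⊥ ν : R) ^ 2 = ∑ μ ∈ lower ν,
          contentProd z z' μ.cells * (dimSkew ⊥ μ : R) *
            (contentProd z z' (ν.cells \ μ.cells) * (dimSkew ⊥ ν : R)) := by
      intro ν hν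
      rw [mem_level] at hν
      rw [sq]
      nth_rw 1 [dimSkew_bot_eq_sum_lower (by omega : ν.card ≠ 0)]
      rw [Nat.cast_sum, Finset.sum_mul, Finset.mul_sum]
      refine Finset.sum_congr rfl fun μ hμ ↦ ?_
      have : contentProd z z' ν.cells =
          contentProd z z' (ν.cells \ μ.cells) * contentProd z z' μ.cells :=
        (Finset.prod_sdiff (mem_lower.1 hμ).1).symm
      rw [this]
      ring
    rw [Finset.sum_congr rfl hs, Finset.sum_comm' (t' := level n) (s' := upper)]
    · calc _ = ∑ μ ∈ level n, (n + 1) * (z * z' + n) *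
            (contentProd z z' μ.cells * (dimSkew ⊥ μ : R) ^ 2) := by
            refine Finset.sum_congr rfl fun μ hμ ↦ ?_
            rw [← Finset.mul_sum, sum_upper_contentProd_mul_dimSkew, mem_level.1 hμ]
            ring
        _ = _ := by
            rw [← Finset.mul_sum, ih, Finset.prod_range_succ, Nat.factorial_succ]
            push_cast
            ring
    · intro ν μ
      simp only [mem_level, mem_lower, mem_upper]
      constructor
      · rintro ⟨h1, h2, h3⟩
        exact ⟨⟨h2, h3⟩, by omega⟩
      · rintro ⟨⟨h1, h2⟩, h3⟩
        exact ⟨by omega, h1, h2⟩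

end ContentProd

end YoungDiagram

open Finset in
theorem hasSum_prod_add_div_factorial_mul_pow (t : ℝ) {x : ℝ} (hx : |x| < 1) :
    HasSum (fun n : ℕ ↦ (∏ i ∈ range n, (t + i)) / n.factorial * x ^ n) (1 / (1 - x) ^ t) := by
  have hp : ∀ n : ℕ, (ascPochhammer ℕ n).smeval t = ∏ i ∈ range n, (t + i) := by
    intro n
    induction n with
    | zero => simp
    | succ n ih =>
      rw [ascPochhammer_succ_right, Polynomial.smeval_mul, Polynomial.smeval_add,
        Polynomial.smeval_X, Polynomial.smeval_natCast, ih, prod_range_succ]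
      simp
  have hc : ∀ n : ℕ, Ring.choose (t + n - 1) n = (∏ i ∈ range n, (t + i)) / n.factorial := by
    intro n
    have hn : (n.factorial : ℝ) ≠ 0 := by positivity
    rw [eq_div_iff hn, ← hp, ← Ring.factorial_nsmul_multichoose_eq_ascPochhammer, Ring.choose,
      nsmul_eq_mul, mul_comm]
    congr 2
    ring
  have hx' : x ∈ Metric.eball (0 : ℝ) 1 := by
    rw [← ENNReal.ofReal_one, Metric.eball_ofReal]
    simpa using hx
  have h := (Real.one_div_one_sub_rpow_hasFPowerSeriesOnBall_zero t).hasSum hx'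
  rw [zero_add] at h
  simpa only [FormalMultilinearSeries.ofScalars_apply_eq, hc, smul_eq_mul] using h

/-- The mixed z-measure `M_{z,z̄,ξ}` is a probability measure: its values sum
to `1` over all Young diagrams. Here `z' = z̄` is nonreal, `0 < ξ < 1`, and
`(1-ξ)^{zz'} = (1-ξ)^{|z|²}` is a positive real power. -/
theorem zMeasure_hasSum_one (z : ℂ) (hz : z.im ≠ 0) (ξ : ℝ) (hξ0 : 0 < ξ) (hξ1 : ξ < 1) :
    HasSum (fun lam : YoungDiagram =>
      (((1 - ξ) ^ Complex.normSq z : ℝ) : ℂ) *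
        contentProd z (starRingEnd ℂ z) lam.cells * (ξ : ℂ) ^ lam.card *
        ((dimSkew ⊥ lam : ℂ) / (Nat.factorial lam.card : ℂ)) ^ 2) 1 := by
  have hcp : ∀ s : Finset (ℕ × ℕ), contentProd z (starRingEnd ℂ z) s =
      ((∏ b ∈ s, Complex.normSq (z + (((b.2 : ℤ) - (b.1 : ℤ) : ℤ) : ℂ)) : ℝ) : ℂ) := by
    intro s
    rw [contentProd, Complex.ofReal_prod]
    refine Finset.prod_congr rfl fun b _ ↦ ?_
    rw [← Complex.mul_conj, map_add, map_intCast]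
  set w : YoungDiagram → ℝ := fun lam ↦ (1 - ξ) ^ Complex.normSq z *
    (∏ b ∈ lam.cells, Complex.normSq (z + (((b.2 : ℤ) - (b.1 : ℤ) : ℤ) : ℂ))) * ξ ^ lam.card *
    ((dimSkew ⊥ lam : ℝ) / (Nat.factorial lam.card : ℝ)) ^ 2 with hw
  have hpos : 0 < (1 - ξ) ^ Complex.normSq z := Real.rpow_pos_of_pos (by linarith) _
  have hw0 : ∀ lam, 0 ≤ w lam := fun lam ↦ by
    have := Finset.prod_nonneg fun b (_ : b ∈ lam.cells) ↦
      Complex.normSq_nonneg (z + (((b.2 : ℤ) - (b.1 : ℤ) : ℤ) : ℂ))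
    positivity
  suffices h : HasSum w 1 by
    convert (Complex.hasSum_ofReal (L := SummationFilter.unconditional _)).2 h using 2 with lam
    · simp only [hw, hcp]
      push_cast
      rfl
    · simp
  have hlevel : ∀ n, HasSum (fun lam : {lam : YoungDiagram // lam.card = n} ↦ w lam)
      ((1 - ξ) ^ Complex.normSq z *
        ((∏ i ∈ Finset.range n, (Complex.normSq z + i)) / n.factorial * ξ ^ n)) := by
    intro n
    have hset : {lam : YoungDiagram | lam.card = n} = YoungDiagram.level n := by
      ext; simp
    have hsum : ∑ lam ∈ YoungDiagram.level n, w lam = (1 - ξ) ^ Complex.normSq z *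
        ((∏ i ∈ Finset.range n, (Complex.normSq z + i)) / n.factorial * ξ ^ n) := by
      have key := YoungDiagram.sum_level_contentProd_mul_dimSkew_sq z (starRingEnd ℂ z) n
      simp only [hcp, Complex.mul_conj] at key
      replace key : ∑ lam ∈ YoungDiagram.level n, (∏ b ∈ lam.cells,
          Complex.normSq (z + (((b.2 : ℤ) - (b.1 : ℤ) : ℤ) : ℂ))) * (dimSkew ⊥ lam : ℝ) ^ 2 =
          n.factorial * ∏ i ∈ Finset.range n, (Complex.normSq z + i) := by
        apply Complex.ofReal_injective
        push_cast at key ⊢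
        exact key
      have hn : (n.factorial : ℝ) ≠ 0 := by positivity
      calc _ = ∑ lam ∈ YoungDiagram.level n, (1 - ξ) ^ Complex.normSq z * ξ ^ n /
            (n.factorial : ℝ) ^ 2 * ((∏ b ∈ lam.cells,
              Complex.normSq (z + (((b.2 : ℤ) - (b.1 : ℤ) : ℤ) : ℂ))) * (dimSkew ⊥ lam : ℝ) ^ 2) := by
            refine Finset.sum_congr rfl fun lam h ↦ ?_
            simp only [hw, YoungDiagram.mem_level.1 h]
            field_simp
        _ = _ := by
            rw [← Finset.mul_sum]
            rw [key]
            field_simp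
    rw [← hsum]
    have hfin := (YoungDiagram.level n).hasSum w
    rwa [← hset] at hfin
  have htot : HasSum (fun n : ℕ ↦ (1 - ξ) ^ Complex.normSq z *
      ((∏ i ∈ Finset.range n, (Complex.normSq z + i)) / n.factorial * ξ ^ n)) 1 := by
    have := (hasSum_prod_add_div_factorial_mul_pow (Complex.normSq z)
      (abs_lt.2 ⟨by linarith, hξ1⟩)).mul_left ((1 - ξ) ^ Complex.normSq z)
    rwa [mul_one_div_cancel hpos.ne'] at this
  rw [← (Equiv.sigmaFiberEquiv YoungDiagram.card).hasSum_iff]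
  have hs : Summable (w ∘ Equiv.sigmaFiberEquiv YoungDiagram.card) := by
    refine (summable_sigma_of_nonneg fun _ ↦ hw0 _).2 ⟨fun n ↦ (hlevel n).summable, ?_⟩
    refine htot.summable.congr fun n ↦ ?_
    exact (hlevel n).tsum_eq.symm
  have := hs.hasSum.sigma fun n ↦ hlevel n
  rw [htot.unique this]
  exact hs.hasSum
end

section
/- The monic Meixner polynomials converge to the monic Laguerre polynomials under scaling: with b > 0 fixed, lim_{ξ→1} (1-ξ)^n M_n((1-ξ)^{-1}x; b, ξ) = L_n(x; b) for each n and each x ∈ ℝ, where M_n is the monic degree-n orthogonal polynomial for the negative binomial weight (b)_k ξ^k/k! on ℤ₊ and L_n is the monic degree-n orthogonal polynomial for x^{b-1}e^{-x} on (0,∞). -/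
section Helpers

open Polynomial Filter Topology MeasureTheory

/-- The linear functional on polynomials with prescribed moments. -/
noncomputable def momentFunctional (m : ℕ → ℝ) : ℝ[X] →ₗ[ℝ] ℝ :=
  Polynomial.lsum fun j => m j • LinearMap.id

theorem momentFunctional_monomial (m : ℕ → ℝ) (j : ℕ) (a : ℝ) :
    momentFunctional m (monomial j a) = m j * a := by
  simp [momentFunctional, Polynomial.lsum_apply, Polynomial.sum_monomial_index]

theorem momentFunctional_X_pow (m : ℕ → ℝ) (j : ℕ) :
    momentFunctional m (X ^ j) = m j := by
  rw [X_pow_eq_monomial, momentFunctional_monomial, mul_one]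

theorem hasSum_momentFunctional {m x w : ℕ → ℝ}
    (h : ∀ j, HasSum (fun k => x k ^ j * w k) (m j)) (p : ℝ[X]) :
    HasSum (fun k => p.eval (x k) * w k) (momentFunctional m p) := by
  induction p using Polynomial.induction_on' with
  | add p q hp hq => simpa only [eval_add, add_mul, map_add] using hp.add hq
  | monomial j a =>
    simpa only [eval_monomial, momentFunctional_monomial, mul_assoc, mul_comm a, mul_left_comm]
      using (h j).mul_left a

theorem integrable_integral_momentFunctional {μ : Measure ℝ} {m : ℕ → ℝ} {w : ℝ → ℝ}
    (hi : ∀ j : ℕ, Integrable (fun x => x ^ j * w x) μ)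
    (h : ∀ j : ℕ, ∫ x, x ^ j * w x ∂μ = m j) (p : ℝ[X]) :
    Integrable (fun x => p.eval x * w x) μ ∧
      ∫ x, p.eval x * w x ∂μ = momentFunctional m p := by
  induction p using Polynomial.induction_on' with
  | add p q hp hq =>
    simp only [eval_add, add_mul, map_add]
    exact ⟨hp.1.add hq.1, by rw [integral_add hp.1 hq.1, hp.2, hq.2]⟩
  | monomial j a =>
    simp only [eval_monomial, momentFunctional_monomial, mul_assoc]
    exact ⟨(hi j).const_mul a, by rw [integral_const_mul, h, mul_comm]⟩

/-- An orthogonal family of monic polynomials is orthogonal to all polynomials of lower degree. -/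
theorem orthogonal_of_degree_lt {Λ : ℝ[X] →ₗ[ℝ] ℝ} {P : ℕ → ℝ[X]}
    (hP : ∀ n, (P n).Monic ∧ (P n).natDegree = n)
    (horth : ∀ m n, m ≠ n → Λ (P m * P n) = 0) (n : ℕ) {d : ℕ} (hd : d ≤ n) {q : ℝ[X]}
    (hq : q.degree < d) : Λ (q * P n) = 0 := by
  induction d generalizing q with
  | zero =>
    have : q = 0 := by simpa using hq
    simp [this]
  | succ d ih =>
    have hr : (q - C (q.coeff d) * P d).degree < d := by
      rw [degree_lt_iff_coeff_zero]
      intro k hk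
      rcases hk.eq_or_lt with rfl | hk
      · have : (P d).coeff d = 1 := by
          simpa [(hP d).2] using (hP d).1.coeff_natDegree
        simp [this]
      · have h1 : q.coeff k = 0 := coeff_eq_zero_of_degree_lt
          (hq.trans_le (by exact_mod_cast hk))
        have h2 : (P d).coeff k = 0 := coeff_eq_zero_of_natDegree_lt (by rw [(hP d).2]; exact hk)
        simp [h1, h2]
    have h0 := ih (by omega) hr
    rw [sub_mul, map_sub, mul_assoc, ← smul_eq_C_mul, map_smul, horth d n (by omega),
      smul_zero, sub_zero] at h0
    exact h0

/-- The Hankel matrix of the first `2 * n - 1` moments. -/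
def hankelMatrix (m : ℕ → ℝ) (n : ℕ) : Matrix (Fin n) (Fin n) ℝ :=
  Matrix.of fun a c => m (a + c)

theorem hankelMatrix_mulVec_coeff (m : ℕ → ℝ) {n : ℕ} {p : ℝ[X]} (hp : p.degree < n) (a : Fin n) :
    (hankelMatrix m n).mulVec (fun c : Fin n => p.coeff c) a = momentFunctional m (X ^ (a : ℕ) * p) := by
  have h : p = ∑ c : Fin n, monomial c (p.coeff c) := by
    exact (Polynomial.sum_monomial_eq p).symm.trans
      (Polynomial.sum_fin (fun j a => (monomial j a : ℝ[X])) (by simp) hp).symm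
  conv_rhs => rw [h]
  simp only [Finset.mul_sum, map_sum, X_pow_mul_monomial, momentFunctional_monomial,
    Matrix.mulVec, dotProduct, hankelMatrix, Matrix.of_apply, add_comm]

/-- The lower coefficients of the monic orthogonal polynomial solve the Hankel system. -/
theorem hankelMatrix_mulVec_orthogonal {m : ℕ → ℝ} {P : ℕ → ℝ[X]}
    (hP : ∀ n, (P n).Monic ∧ (P n).natDegree = n)
    (horth : ∀ i j, i ≠ j → momentFunctional m (P i * P j) = 0) (n : ℕ) :
    (hankelMatrix m n).mulVec (fun c : Fin n => (P n).coeff c) = fun a : Fin n => -m (a + n) := by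
  have hlt : (P n - X ^ n).degree < (n : WithBot ℕ) := by
    rw [degree_lt_iff_coeff_zero]
    intro k hk
    rcases hk.eq_or_lt with rfl | hk
    · have : (P n).coeff n = 1 := by simpa [(hP n).2] using (hP n).1.coeff_natDegree
      simp [this]
    · have h2 : (P n).coeff k = 0 := coeff_eq_zero_of_natDegree_lt (by rw [(hP n).2]; exact hk)
      simp [h2, coeff_X_pow, hk.ne']
  have hcoeff : (fun c : Fin n => (P n).coeff c) = fun c : Fin n => (P n - X ^ n).coeff c := by
    funext c
    simp [coeff_X_pow, c.isLt.ne]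
  funext a
  rw [hcoeff, hankelMatrix_mulVec_coeff m hlt, mul_sub, map_sub, ← pow_add, momentFunctional_X_pow,
    orthogonal_of_degree_lt hP horth n le_rfl
      ((degree_X_pow_le _).trans_lt (by exact_mod_cast a.isLt)), zero_sub]

theorem hankelMatrix_det_ne_zero {m : ℕ → ℝ}
    (hpos : ∀ q : ℝ[X], momentFunctional m (q * q) = 0 → q = 0) (n : ℕ) :
    (hankelMatrix m n).det ≠ 0 := by
  intro hdet
  obtain ⟨v, hv, hmul⟩ := Matrix.exists_mulVec_eq_zero_iff.mpr hdet
  set q : ℝ[X] := ∑ c : Fin n, monomial c (v c) with hq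
  have hcoeff (c : Fin n) : q.coeff c = v c := by
    simp [hq, coeff_monomial, Fin.val_inj]
  have hdeg : q.degree < n := by
    rw [degree_lt_iff_coeff_zero]
    intro k hk
    simp only [hq, finsetSum_coeff, coeff_monomial]
    exact Finset.sum_eq_zero fun c _ => if_neg (by omega)
  have hX (a : Fin n) : momentFunctional m (X ^ (a : ℕ) * q) = 0 := by
    rw [← hankelMatrix_mulVec_coeff m hdeg, funext hcoeff, hmul, Pi.zero_apply]
  have hzero : momentFunctional m (q * q) = 0 := by
    conv_lhs => enter [2, 1]; rw [hq]
    simp only [Finset.sum_mul, map_sum]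
    refine Finset.sum_eq_zero fun a _ => ?_
    rw [← C_mul_X_pow_eq_monomial, mul_assoc, ← smul_eq_C_mul, map_smul, hX, smul_zero]
  have h0 := hpos q hzero
  exact hv (funext fun c => by rw [← hcoeff c, h0]; simp)

theorem inv_det_mul_adjugate_mulVec {n : ℕ} {H : Matrix (Fin n) (Fin n) ℝ} {u v : Fin n → ℝ}
    (hdet : H.det ≠ 0) (h : H.mulVec u = v) (a : Fin n) :
    H.det⁻¹ * H.adjugate.mulVec v a = u a := by
  rw [← h, Matrix.mulVec_mulVec, Matrix.adjugate_mul, Matrix.smul_mulVec, Matrix.one_mulVec,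
    Pi.smul_apply, smul_eq_mul, inv_mul_cancel_left₀ hdet]

theorem tendsto_det {ι : Type*} {l : Filter ι} {n : ℕ} {H : ι → Matrix (Fin n) (Fin n) ℝ}
    {H₀ : Matrix (Fin n) (Fin n) ℝ} (hH : Tendsto H l (𝓝 H₀)) :
    Tendsto (fun i => (H i).det) l (𝓝 H₀.det) :=
  ((Continuous.matrix_det continuous_id).tendsto H₀).comp hH

theorem tendsto_inv_det_mul_adjugate_mulVec {ι : Type*} {l : Filter ι} {n : ℕ}
    {H : ι → Matrix (Fin n) (Fin n) ℝ} {H₀ : Matrix (Fin n) (Fin n) ℝ} {v : ι → Fin n → ℝ}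
    {v₀ : Fin n → ℝ} (hH : Tendsto H l (𝓝 H₀)) (hv : Tendsto v l (𝓝 v₀)) (hdet : H₀.det ≠ 0)
    (a : Fin n) :
    Tendsto (fun i => (H i).det⁻¹ * (H i).adjugate.mulVec (v i) a) l
      (𝓝 (H₀.det⁻¹ * H₀.adjugate.mulVec v₀ a)) := by
  have hadj : Tendsto (fun i => (H i).adjugate) l (𝓝 H₀.adjugate) :=
    ((Continuous.matrix_adjugate continuous_id).tendsto H₀).comp hH
  have hmul : Tendsto (fun i => ∑ c, (H i).adjugate a c * v i c) l
      (𝓝 (∑ c, H₀.adjugate a c * v₀ c)) :=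
    tendsto_finsetSum _ fun c _ =>
      (tendsto_pi_nhds.mp (tendsto_pi_nhds.mp hadj a) c).mul (tendsto_pi_nhds.mp hv c)
  exact ((tendsto_det hH).inv₀ hdet).mul hmul

/-- If the moments converge to those of a nondegenerate functional, then the coefficients of the
monic orthogonal polynomials converge. -/
theorem tendsto_coeff_of_tendsto_moments {ι : Type*} {l : Filter ι} {m : ι → ℕ → ℝ} {m₀ : ℕ → ℝ}
    (hm : ∀ j, Tendsto (fun i => m i j) l (𝓝 (m₀ j))) {P : ι → ℕ → ℝ[X]} {Q : ℕ → ℝ[X]}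
    (hP : ∀ᶠ i in l, ∀ n, (P i n).Monic ∧ (P i n).natDegree = n)
    (hPorth : ∀ᶠ i in l, ∀ j k, j ≠ k → momentFunctional (m i) (P i j * P i k) = 0)
    (hQ : ∀ n, (Q n).Monic ∧ (Q n).natDegree = n)
    (hQorth : ∀ j k, j ≠ k → momentFunctional m₀ (Q j * Q k) = 0)
    (hpos : ∀ q : ℝ[X], momentFunctional m₀ (q * q) = 0 → q = 0) {n k : ℕ} (hk : k < n) :
    Tendsto (fun i => (P i n).coeff k) l (𝓝 ((Q n).coeff k)) := by
  have hdet₀ := hankelMatrix_det_ne_zero hpos n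
  have hH : Tendsto (fun i => hankelMatrix (m i) n) l (𝓝 (hankelMatrix m₀ n)) :=
    tendsto_pi_nhds.mpr fun a => tendsto_pi_nhds.mpr fun c => hm (a + c)
  have hv : Tendsto (fun i => fun a : Fin n => -m i (a + n)) l
      (𝓝 fun a : Fin n => -m₀ (a + n)) :=
    tendsto_pi_nhds.mpr fun a => (hm (a + n)).neg
  have hlim := tendsto_inv_det_mul_adjugate_mulVec hH hv hdet₀ ⟨k, hk⟩
  rw [inv_det_mul_adjugate_mulVec hdet₀ (hankelMatrix_mulVec_orthogonal hQ hQorth n)] at hlim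
  refine hlim.congr' ?_
  filter_upwards [hP, hPorth, (tendsto_det hH).eventually_ne hdet₀] with i h1 h2 h3
  exact inv_det_mul_adjugate_mulVec h3 (hankelMatrix_mulVec_orthogonal h1 h2 n) ⟨k, hk⟩

theorem tendsto_eval_of_tendsto_coeff {ι : Type*} {l : Filter ι} {P : ι → ℝ[X]} {Q : ℝ[X]} {n : ℕ}
    (hP : ∀ᶠ i in l, (P i).Monic ∧ (P i).natDegree = n) (hQ : Q.Monic ∧ Q.natDegree = n)
    (h : ∀ k < n, Tendsto (fun i => (P i).coeff k) l (𝓝 (Q.coeff k))) (x : ℝ) :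
    Tendsto (fun i => (P i).eval x) l (𝓝 (Q.eval x)) := by
  have expand {p : ℝ[X]} (hp : p.Monic ∧ p.natDegree = n) :
      ∑ k ∈ Finset.range n, p.coeff k * x ^ k + x ^ n = p.eval x := by
    have h1 : p.coeff n = 1 := by simpa [hp.2] using hp.1.coeff_natDegree
    rw [eval_eq_sum_range, hp.2, Finset.sum_range_succ, h1, one_mul]
  rw [← expand hQ]
  refine Tendsto.congr' ?_ ((tendsto_finsetSum _ fun k hk =>
    (h k (Finset.mem_range.mp hk)).mul_const (x ^ k)).add_const (x ^ n))
  filter_upwards [hP] with i hi using expand hi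

theorem integrableOn_pow_mul_gammaWeight {b : ℝ} (hb : 0 < b) (j : ℕ) :
    IntegrableOn (fun x : ℝ => x ^ j * (x ^ (b - 1) * Real.exp (-x))) (Set.Ioi 0) ∧
      ∫ x in Set.Ioi (0 : ℝ), x ^ j * (x ^ (b - 1) * Real.exp (-x)) = Real.Gamma (b + j) := by
  have hbj : 0 < b + j := by positivity
  have heq : Set.EqOn (fun x : ℝ => Real.exp (-x) * x ^ (b + j - 1))
      (fun x : ℝ => x ^ j * (x ^ (b - 1) * Real.exp (-x))) (Set.Ioi 0) := fun x hx => by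
    have : (x : ℝ) ^ (b + j - 1) = x ^ (b - 1) * x ^ j := by
      rw [← Real.rpow_natCast, ← Real.rpow_add hx]
      ring_nf
    simp only [this]
    ring
  exact ⟨(Real.GammaIntegral_convergent hbj).congr_fun heq measurableSet_Ioi,
    by rw [Real.Gamma_eq_integral hbj, setIntegral_congr_fun measurableSet_Ioi heq]⟩

theorem integral_gammaWeight {b : ℝ} (hb : 0 < b) (p : ℝ[X]) :
    IntegrableOn (fun x : ℝ => p.eval x * (x ^ (b - 1) * Real.exp (-x))) (Set.Ioi 0) ∧
      ∫ x in Set.Ioi (0 : ℝ), p.eval x * (x ^ (b - 1) * Real.exp (-x)) =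
        momentFunctional (fun j => Real.Gamma (b + j)) p :=
  integrable_integral_momentFunctional (fun j => (integrableOn_pow_mul_gammaWeight hb j).1)
    (fun j => (integrableOn_pow_mul_gammaWeight hb j).2) p

theorem eq_zero_of_gammaFunctional_mul_self {b : ℝ} (hb : 0 < b) {q : ℝ[X]}
    (hq : momentFunctional (fun j => Real.Gamma (b + j)) (q * q) = 0) : q = 0 := by
  by_contra hne
  obtain ⟨hint, heq⟩ := integral_gammaWeight hb (q * q)
  rw [hq, setIntegral_eq_zero_iff_of_nonneg_ae _ hint] at heq
  · have hroots : ∀ᵐ x ∂volume.restrict (Set.Ioi (0 : ℝ)), x ∉ {x | q.IsRoot x} :=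
      ae_restrict_of_ae (measure_eq_zero_iff_ae_notMem.mp
        ((Polynomial.finite_setOfPred_isRoot hne).measure_zero volume))
    have hfalse : ∀ᵐ x ∂volume.restrict (Set.Ioi (0 : ℝ)), False := by
      filter_upwards [heq, hroots, ae_restrict_mem measurableSet_Ioi] with x h1 h2 hx
      have hw : x ^ (b - 1) * Real.exp (-x) ≠ 0 :=
        (mul_pos (Real.rpow_pos_of_pos hx _) (Real.exp_pos _)).ne'
      simp only [eval_mul, Pi.zero_apply] at h1
      exact h2 (mul_self_eq_zero.mp ((mul_eq_zero.mp h1).resolve_right hw))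
    rw [ae_iff] at hfalse
    simp at hfalse
  · filter_upwards [ae_restrict_mem measurableSet_Ioi] with x hx
    have hx : (0 : ℝ) < x := hx
    rw [eval_mul]
    exact mul_nonneg (mul_self_nonneg _) (by positivity)

/-- The negative binomial weight. -/
noncomputable def meixnerWeight (b ξ : ℝ) (k : ℕ) : ℝ :=
  (ascPochhammer ℝ k).eval b * ξ ^ k / (Nat.factorial k : ℝ)

theorem meixnerWeight_pos {b ξ : ℝ} (hb : 0 < b) (hξ : 0 < ξ) (k : ℕ) :
    0 < meixnerWeight b ξ k := by
  have := ascPochhammer_pos k b hb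
  unfold meixnerWeight
  positivity

theorem succ_mul_meixnerWeight_succ (b ξ : ℝ) (k : ℕ) :
    (k + 1) * meixnerWeight b ξ (k + 1) = ξ * (b + k) * meixnerWeight b ξ k := by
  have : (k : ℝ) + 1 ≠ 0 := by positivity
  have : (Nat.factorial k : ℝ) ≠ 0 := by positivity
  rw [meixnerWeight, meixnerWeight, ascPochhammer_succ_eval, Nat.factorial_succ]
  push_cast
  field_simp
  ring

theorem summable_pow_mul_meixnerWeight {b ξ : ℝ} (hb : 0 < b) (hξ : ξ ∈ Set.Ioo (0 : ℝ) 1) (j : ℕ) :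
    Summable fun k : ℕ => (k : ℝ) ^ j * meixnerWeight b ξ k := by
  have hpos {k : ℕ} (hk : 0 < k) : 0 < (k : ℝ) ^ j * meixnerWeight b ξ k :=
    mul_pos (by positivity) (meixnerWeight_pos hb hξ.1 k)
  refine summable_of_ratio_test_tendsto_lt_one hξ.2
    (eventually_atTop.mpr ⟨1, fun k hk => (hpos hk).ne'⟩) ?_
  have h1 : Tendsto (fun k : ℕ => (1 : ℝ) + 1 / (k : ℝ)) atTop (𝓝 (1 + 0)) :=
    tendsto_one_div_atTop_nhds_zero_nat.const_add 1
  have h2 : Tendsto (fun k : ℕ => (1 : ℝ) + (b - 1) * (1 / ((k : ℝ) + 1))) atTop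
      (𝓝 (1 + (b - 1) * 0)) :=
    (tendsto_one_div_add_atTop_nhds_zero_nat.const_mul (b - 1)).const_add 1
  have h3 := ((h1.pow j).mul h2).const_mul ξ
  simp only [add_zero, one_pow, mul_zero, mul_one] at h3
  refine h3.congr' (eventually_atTop.mpr ⟨1, fun k hk => ?_⟩)
  have hk0 : (k : ℝ) ≠ 0 := by positivity
  have hk1 : (k : ℝ) + 1 ≠ 0 := by positivity
  have hw := (meixnerWeight_pos hb hξ.1 k).ne'
  have hsucc : meixnerWeight b ξ (k + 1) = ξ * (b + k) * meixnerWeight b ξ k / (k + 1) := by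
    rw [← succ_mul_meixnerWeight_succ, mul_div_cancel_left₀ _ hk1]
  beta_reduce
  rw [Real.norm_of_nonneg (hpos k.succ_pos).le, Real.norm_of_nonneg (hpos hk).le, hsucc]
  have : (1 : ℝ) + 1 / k = (k + 1) / k := by field_simp
  rw [this, div_pow]
  push_cast
  field_simp
  ring

theorem summable_eval_mul_meixnerWeight {b ξ : ℝ} (hb : 0 < b) (hξ : ξ ∈ Set.Ioo (0 : ℝ) 1)
    (p : ℝ[X]) : Summable fun k : ℕ => p.eval (k : ℝ) * meixnerWeight b ξ k :=
  (hasSum_momentFunctional (x := fun k => (k : ℝ))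
    (fun j => (summable_pow_mul_meixnerWeight hb hξ j).hasSum) p).summable

/-- Mixed power and factorial moments of the negative binomial weight, rescaled by `1 - ξ`. -/
noncomputable def meixnerMixedMoment (b ξ : ℝ) (i k : ℕ) : ℝ :=
  ∑' j : ℕ, ((1 - ξ) * j) ^ i * ((1 - ξ) ^ k * j.descFactorial k) * meixnerWeight b ξ j

theorem summable_meixnerMixedMoment {b ξ : ℝ} (hb : 0 < b) (hξ : ξ ∈ Set.Ioo (0 : ℝ) 1)
    (i k : ℕ) : Summable fun j : ℕ =>
      ((1 - ξ) * j) ^ i * ((1 - ξ) ^ k * j.descFactorial k) * meixnerWeight b ξ j := by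
  convert summable_eval_mul_meixnerWeight hb hξ
    ((C (1 - ξ) * X) ^ i * (C ((1 - ξ) ^ k) * descPochhammer ℝ k)) using 3 with j
  simp [descPochhammer_eval_eq_descFactorial]

theorem cast_descFactorial_succ (j k : ℕ) :
    (j.descFactorial (k + 1) : ℝ) = (j - k) * j.descFactorial k := by
  simp only [← descPochhammer_eval_eq_descFactorial ℝ, descPochhammer_succ_eval]
  ring

theorem meixnerMixedMoment_zero_succ {b ξ : ℝ} (hb : 0 < b) (hξ : ξ ∈ Set.Ioo (0 : ℝ) 1) (k : ℕ) :
    meixnerMixedMoment b ξ 0 (k + 1) = ξ * (b + k) * meixnerMixedMoment b ξ 0 k := by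
  have hh : 1 - ξ ≠ 0 := (sub_pos.mpr hξ.2).ne'
  have key : meixnerMixedMoment b ξ 0 (k + 1) =
      ξ * ((1 - ξ) * (b + k) * meixnerMixedMoment b ξ 0 k + meixnerMixedMoment b ξ 0 (k + 1)) := by
    conv_lhs =>
      rw [meixnerMixedMoment, (summable_meixnerMixedMoment hb hξ 0 (k + 1)).tsum_eq_zero_add]
    rw [meixnerMixedMoment, meixnerMixedMoment, ← tsum_mul_left,
      ← ((summable_meixnerMixedMoment hb hξ 0 k).mul_left _).tsum_add
        (summable_meixnerMixedMoment hb hξ 0 (k + 1)), ← tsum_mul_left]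
    simp only [Nat.zero_descFactorial_succ, Nat.cast_zero, mul_zero, zero_mul, zero_add, pow_zero,
      one_mul]
    refine tsum_congr fun j => ?_
    have h1 := succ_mul_meixnerWeight_succ b ξ j
    rw [Nat.succ_descFactorial_succ, cast_descFactorial_succ]
    push_cast
    linear_combination (1 - ξ) ^ (k + 1) * (j.descFactorial k : ℝ) * h1
  refine mul_left_cancel₀ hh ?_
  linear_combination key

theorem meixnerMixedMoment_succ {b ξ : ℝ} (hb : 0 < b) (hξ : ξ ∈ Set.Ioo (0 : ℝ) 1) (i k : ℕ) :
    meixnerMixedMoment b ξ (i + 1) k =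
      meixnerMixedMoment b ξ i (k + 1) + (1 - ξ) * k * meixnerMixedMoment b ξ i k := by
  rw [meixnerMixedMoment, meixnerMixedMoment, meixnerMixedMoment, ← tsum_mul_left,
    ← (summable_meixnerMixedMoment hb hξ i (k + 1)).tsum_add
      ((summable_meixnerMixedMoment hb hξ i k).mul_left _)]
  refine tsum_congr fun j => ?_
  rw [cast_descFactorial_succ]
  ring

theorem meixnerMixedMoment_zero_zero_pos {b ξ : ℝ} (hb : 0 < b) (hξ : ξ ∈ Set.Ioo (0 : ℝ) 1) :
    0 < meixnerMixedMoment b ξ 0 0 := by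
  refine (summable_meixnerMixedMoment hb hξ 0 0).tsum_pos (fun j => ?_) 0 ?_
  · simpa using (meixnerWeight_pos hb hξ.1 j).le
  · simpa using meixnerWeight_pos hb hξ.1 0

theorem tendsto_meixnerMixedMoment {b : ℝ} (hb : 0 < b) (i k : ℕ) :
    Tendsto (fun ξ => Real.Gamma b / meixnerMixedMoment b ξ 0 0 * meixnerMixedMoment b ξ i k)
      (𝓝[Set.Ioo 0 1] 1) (𝓝 (Real.Gamma (b + i + k))) := by
  have hid : Tendsto (fun ξ : ℝ => ξ) (𝓝[Set.Ioo 0 1] 1) (𝓝 1) :=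
    tendsto_id.mono_left nhdsWithin_le_nhds
  induction i generalizing k with
  | zero =>
    induction k with
    | zero =>
      simp only [Nat.cast_zero, add_zero]
      refine tendsto_const_nhds.congr' ?_
      filter_upwards [self_mem_nhdsWithin] with ξ hξ
      rw [div_mul_cancel₀ _ (meixnerMixedMoment_zero_zero_pos hb hξ).ne']
    | succ k ih =>
      have hlim := (hid.mul_const (b + k)).mul ih
      have hG : Real.Gamma (b + (0 : ℕ) + (k + 1 : ℕ)) =
          1 * (b + k) * Real.Gamma (b + (0 : ℕ) + k) := by
        push_cast
        rw [add_zero, ← add_assoc, Real.Gamma_add_one (by positivity), one_mul]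
      rw [hG]
      refine hlim.congr' ?_
      filter_upwards [self_mem_nhdsWithin] with ξ hξ
      rw [meixnerMixedMoment_zero_succ hb hξ]
      ring
  | succ i ih =>
    have hlim := (ih (k + 1)).add (((hid.const_sub 1).mul_const (k : ℝ)).mul (ih k))
    have hG : Real.Gamma (b + (i + 1 : ℕ) + k) =
        Real.Gamma (b + i + (k + 1 : ℕ)) + (1 - 1) * k * Real.Gamma (b + i + k) := by
      push_cast
      ring_nf
    rw [hG]
    refine hlim.congr' ?_
    filter_upwards [self_mem_nhdsWithin] with ξ hξ
    rw [meixnerMixedMoment_succ hb hξ]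
    ring

theorem meixnerFunctional_scaleRoots_mul_scaleRoots {b ξ : ℝ} (hb : 0 < b)
    (hξ : ξ ∈ Set.Ioo (0 : ℝ) 1) (c : ℝ) {p q : ℝ[X]}
    (h : ∑' k : ℕ, p.eval (k : ℝ) * q.eval (k : ℝ) * meixnerWeight b ξ k = 0) :
    momentFunctional (fun i => c * meixnerMixedMoment b ξ i 0)
      (p.scaleRoots (1 - ξ) * q.scaleRoots (1 - ξ)) = 0 := by
  have hmom (i : ℕ) : HasSum (fun k : ℕ => ((1 - ξ) * k) ^ i * (c * meixnerWeight b ξ k))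
      (c * meixnerMixedMoment b ξ i 0) := by
    refine ((summable_meixnerMixedMoment hb hξ i 0).hasSum.mul_left c).congr_fun fun k => ?_
    simp only [pow_zero, Nat.descFactorial_zero, Nat.cast_one, mul_one]
    ring
  rw [← (hasSum_momentFunctional hmom _).tsum_eq]
  simp only [eval_mul, scaleRoots_eval_mul]
  rw [← mul_zero ((1 - ξ) ^ p.natDegree * (1 - ξ) ^ q.natDegree * c), ← h, ← tsum_mul_left]
  exact tsum_congr fun k => by ring

end Helpers


/-- Meixner → Laguerre scaling limit: if `M ξ n` is the monic degree-`n`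
orthogonal polynomial for the negative binomial weight `(b)_k ξ^k / k!` on `ℤ₊`
and `L n` is the monic degree-`n` orthogonal polynomial for `x^{b-1}e^{-x}` on
`(0,∞)`, then `lim_{ξ↑1} (1-ξ)^n M_n((1-ξ)^{-1} x) = L_n(x)`. -/
theorem meixner_tendsto_laguerre (b : ℝ) (hb : 0 < b)
    (L : ℕ → Polynomial ℝ)
    (hLmonic : ∀ n, (L n).Monic) (hLdeg : ∀ n, (L n).natDegree = n)
    (hLorth : ∀ m n : ℕ, m ≠ n →
      ∫ x in Set.Ioi (0 : ℝ),
        (L m).eval x * (L n).eval x * x ^ (b - 1) * Real.exp (-x) = 0)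
    (M : ℝ → ℕ → Polynomial ℝ)
    (hMmonic : ∀ ξ ∈ Set.Ioo (0 : ℝ) 1, ∀ n, (M ξ n).Monic ∧ (M ξ n).natDegree = n)
    (hMorth : ∀ ξ ∈ Set.Ioo (0 : ℝ) 1, ∀ m n : ℕ, m ≠ n →
      ∑' k : ℕ, (M ξ m).eval (k : ℝ) * (M ξ n).eval (k : ℝ) *
        ((ascPochhammer ℝ k).eval b * ξ ^ k / (Nat.factorial k : ℝ)) = 0)
    (n : ℕ) (x : ℝ) :
    Filter.Tendsto (fun ξ : ℝ => (1 - ξ) ^ n * (M ξ n).eval ((1 - ξ)⁻¹ * x))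
      (nhdsWithin 1 (Set.Ioo 0 1)) (nhds ((L n).eval x)) := by
  have hL (n : ℕ) : (L n).Monic ∧ (L n).natDegree = n := ⟨hLmonic n, hLdeg n⟩
  have hP : ∀ᶠ ξ in nhdsWithin (1 : ℝ) (Set.Ioo 0 1), ∀ n,
      ((M ξ n).scaleRoots (1 - ξ)).Monic ∧ ((M ξ n).scaleRoots (1 - ξ)).natDegree = n := by
    filter_upwards [self_mem_nhdsWithin] with ξ hξ n
    exact ⟨(Polynomial.monic_scaleRoots_iff _).mpr (hMmonic ξ hξ n).1,
      (Polynomial.natDegree_scaleRoots _ _).trans (hMmonic ξ hξ n).2⟩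
  have hmom (j : ℕ) := tendsto_meixnerMixedMoment hb j 0
  simp only [Nat.cast_zero, add_zero] at hmom
  have hlim := tendsto_eval_of_tendsto_coeff (hP.mono fun ξ h => h n) (hL n)
    (fun k hk => tendsto_coeff_of_tendsto_moments hmom hP
      (by
        filter_upwards [self_mem_nhdsWithin] with ξ hξ j k hjk
        exact meixnerFunctional_scaleRoots_mul_scaleRoots hb hξ _ (hMorth ξ hξ j k hjk))
      hL
      (fun j k hjk => by
        rw [← (integral_gammaWeight hb _).2]
        refine Eq.trans ?_ (hLorth j k hjk)
        simp only [Polynomial.eval_mul, mul_assoc])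
      (fun q hq => eq_zero_of_gammaFunctional_mul_self hb hq) hk) x
  refine hlim.congr' ?_
  filter_upwards [self_mem_nhdsWithin] with ξ hξ
  have hh : 1 - ξ ≠ 0 := (sub_pos.mpr hξ.2).ne'
  conv_lhs => rw [← mul_inv_cancel_left₀ hh x, Polynomial.scaleRoots_eval_mul, (hMmonic ξ hξ n).2]
end
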